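/- Let G₁ and G₂ be discrete convergence groups acting on a compact metrizable space M, suppose J = G₁ ∩ G₂ is geometrically finite and a proper subgroup of both G₁ and G₂, suppose G₁ and G₂ are in AFP ping-pong position with respect to J, and let G = ⟨G₁, G₂⟩ act on M as a convergence group. Assume G is geometrically finite. Let x ∈ Λ(G_i) for i ∈ {1,2}, and suppose (h_k) is a conical limiting sequence in G for x, i.e. a sequence of pairwise distinct elements of G such that for every z ∈ M ∖ {x} the pairs (h_k x, h_k z) remain in a compact subset of (M × M) ∖ Δ. Then after passing to a subsequence there exists h ∈ G such that h_k ∈ h G_i for every k. -/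

import Mathlib

open Filter Topology Set

namespace ConvergenceGroups

variable {M : Type*} [TopologicalSpace M]

/-- The group of self-homeomorphisms of `M`, with `(g * h) x = g (h x)`. -/
instance : Group (M ≃ₜ M) where
  mul g h := h.trans g
  one := Homeomorph.refl M
  inv := Homeomorph.symm
  mul_assoc _ _ _ := rfl
  one_mul _ := Homeomorph.ext fun _ => rfl
  mul_one _ := Homeomorph.ext fun _ => rfl
  inv_mul_cancel g := Homeomorph.ext fun x => g.symm_apply_apply x

/-- The inclusion of the self-homeomorphisms of `M` into the continuous self-maps of `M`;
the latter carries the compact-open topology. -/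
def toCM (g : M ≃ₜ M) : C(M, M) := ⟨⇑g, g.continuous⟩

/-- `(g k)` is a convergence sequence with attracting point `zp` and repelling point `zm`:
the maps `g k` converge to the constant map `zp` uniformly on compact subsets of
`M ∖ {zm}`. -/
def IsConvSeq (g : ℕ → M ≃ₜ M) (zp zm : M) : Prop :=
  ∀ K : Set M, IsCompact K → zm ∉ K → ∀ U ∈ 𝓝 zp,
    ∀ᶠ k in atTop, ∀ x ∈ K, g k x ∈ U

/-- `(g k)` converges in the compact-open topology to a homeomorphism. -/
def TendstoHomeo (g : ℕ → M ≃ₜ M) : Prop :=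
  ∃ h : M ≃ₜ M, Tendsto (fun k => toCM (g k)) atTop (𝓝 (toCM h))

/-- `G` acts on `M` as a convergence group: every sequence of pairwise distinct elements of
`G` has a subsequence which either converges in the compact-open topology to a
homeomorphism, or is a convergence sequence. -/
def IsConvGroup (G : Subgroup (M ≃ₜ M)) : Prop :=
  ∀ g : ℕ → M ≃ₜ M, (∀ k, g k ∈ G) → Function.Injective g →
    ∃ φ : ℕ → ℕ, StrictMono φ ∧
      (TendstoHomeo (g ∘ φ) ∨ ∃ zp zm : M, IsConvSeq (g ∘ φ) zp zm)

/-- `G` acts on `M` as a discrete convergence group: every sequence of pairwise distinct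
elements of `G` has a subsequence which is a convergence sequence. -/
def IsDiscreteConvGroup (G : Subgroup (M ≃ₜ M)) : Prop :=
  ∀ g : ℕ → M ≃ₜ M, (∀ k, g k ∈ G) → Function.Injective g →
    ∃ φ : ℕ → ℕ, StrictMono φ ∧ ∃ zp zm : M, IsConvSeq (g ∘ φ) zp zm

/-- The limit set `Λ(G)`: the set of all attracting points of convergence sequences in `G`. -/
def limitSet (G : Subgroup (M ≃ₜ M)) : Set M :=
  {zp | ∃ g : ℕ → M ≃ₜ M, (∀ k, g k ∈ G) ∧ Function.Injective g ∧
    ∃ zm : M, IsConvSeq g zp zm}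

/-- `x` is a conical limit point for `G`: there is a sequence of pairwise distinct elements
`g k` of `G` such that for every `z ≠ x` the pairs `(g k x, g k z)` remain in a compact
subset of `(M × M) ∖ Δ`. -/
def IsConicalLimitPt (G : Subgroup (M ≃ₜ M)) (x : M) : Prop :=
  ∃ g : ℕ → M ≃ₜ M, (∀ k, g k ∈ G) ∧ Function.Injective g ∧
    ∀ z : M, z ≠ x → ∃ K : Set (M × M), IsCompact K ∧ (∀ p ∈ K, p.1 ≠ p.2) ∧
      ∀ k, (g k x, g k z) ∈ K

/-- `g` is elliptic: the closure of the cyclic group generated by `g` is compact in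
`Homeo(M)` (viewed inside `C(M, M)` with the compact-open topology). -/
def IsEllipticElem (g : M ≃ₜ M) : Prop :=
  IsCompact (closure (Set.range fun n : ℤ => toCM (g ^ n))) ∧
    closure (Set.range fun n : ℤ => toCM (g ^ n)) ⊆ Set.range (toCM (M := M))

/-- `g` is parabolic: not elliptic, and fixes exactly one point of `M`. -/
def IsParabolicElem (g : M ≃ₜ M) : Prop :=
  ¬IsEllipticElem g ∧ ∃! x : M, g x = x

/-- `g` is loxodromic: not elliptic, and fixes exactly two points of `M`. -/
def IsLoxodromicElem (g : M ≃ₜ M) : Prop :=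
  ¬IsEllipticElem g ∧ ∃ a b : M, a ≠ b ∧ {x : M | g x = x} = {a, b}

/-- `p` is a parabolic point for `G`: it is the fixed point of a parabolic element of `G`. -/
def IsParabolicPt (G : Subgroup (M ≃ₜ M)) (p : M) : Prop :=
  ∃ g ∈ G, IsParabolicElem g ∧ g p = p

/-- `p` is a bounded parabolic point for `G`: it is a parabolic point and the quotient of
`Λ(G) ∖ {p}` by the stabilizer of `p` in `G` is compact. -/
def IsBoundedParabolicPt (G : Subgroup (M ≃ₜ M)) (p : M) : Prop :=
  IsParabolicPt G p ∧
    ∃ K : Set M, IsCompact K ∧ K ⊆ limitSet G \ {p} ∧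
      ∀ x ∈ limitSet G \ {p}, ∃ h ∈ G, h p = p ∧ h x ∈ K

/-- `G` is geometrically finite: every point of `Λ(G)` is a conical limit point or a
bounded parabolic point. -/
def IsGeomFinite (G : Subgroup (M ≃ₜ M)) : Prop :=
  ∀ x ∈ limitSet G, IsConicalLimitPt G x ∨ IsBoundedParabolicPt G x

/-- `J` is a fully quasi-convex subgroup of `G`: `J ≤ G`, `J` acts geometrically finitely,
and `g Λ(J) ∩ Λ(J) = ∅` for all but finitely many left cosets `gJ`. -/
def IsFullyQuasiconvex (G J : Subgroup (M ≃ₜ M)) : Prop :=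
  J ≤ G ∧ IsGeomFinite J ∧
    ∃ F : Set (M ≃ₜ M), F.Finite ∧ ∀ g ∈ G,
      (⇑g '' limitSet J ∩ limitSet J).Nonempty → ∃ f ∈ F, ∃ j ∈ J, g = f * j

/-- `G₁` and `G₂` are in AFP ping-pong position with respect to `J = G₁ ∩ G₂`, witnessed by
the closed sets `B₁`, `B₂`. -/
structure AFPPingPong (G₁ G₂ J : Subgroup (M ≃ₜ M)) (B₁ B₂ : Set M) : Prop where
  isClosed₁ : IsClosed B₁
  isClosed₂ : IsClosed B₂
  int_nonempty₁ : (interior B₁).Nonempty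
  int_nonempty₂ : (interior B₂).Nonempty
  int_disjoint : interior B₁ ∩ interior B₂ = ∅
  inv₁ : ∀ j ∈ J, ⇑j '' B₁ = B₁
  inv₂ : ∀ j ∈ J, ⇑j '' B₂ = B₂
  pp₁ : ∀ g ∈ G₁, g ∉ J → ⇑g '' B₁ ⊆ interior B₂
  pp₂ : ∀ g ∈ G₂, g ∉ J → ⇑g '' B₂ ⊆ interior B₁
  lim₁ : limitSet G₁ \ limitSet J ⊆ interior B₂
  lim₂ : limitSet G₂ \ limitSet J ⊆ interior B₁

/-- `G₀` is in HNN ping-pong position with respect to `f`, `J₁`, `J₋₁`, witnessed by the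
closed sets `B₁`, `Bm` (where `Bm` plays the role of `B₋₁`). -/
structure HNNPingPong (G₀ J₁ Jm : Subgroup (M ≃ₜ M)) (f : M ≃ₜ M) (B₁ Bm : Set M) :
    Prop where
  isClosed₁ : IsClosed B₁
  isClosedm : IsClosed Bm
  int_nonempty₁ : (interior B₁).Nonempty
  int_nonemptym : (interior Bm).Nonempty
  int_disjoint : interior B₁ ∩ interior Bm = ∅
  inv₁ : ∀ j ∈ J₁, ⇑j '' B₁ = B₁
  invm : ∀ j ∈ Jm, ⇑j '' Bm = Bm
  prec₁ : ∀ g ∈ G₀, g ∉ J₁ → ⇑g '' B₁ ∩ B₁ = ∅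
  precm : ∀ g ∈ G₀, g ∉ Jm → ⇑g '' Bm ∩ Bm = ∅
  cross : ∀ g ∈ G₀, ⇑g '' B₁ ∩ Bm = ∅
  mapf : ⇑f '' ((B₁ ∪ Bm)ᶜ ∪ B₁) = interior B₁
  lim₁ : limitSet G₀ ∩ B₁ = limitSet J₁
  limm : limitSet G₀ ∩ Bm = limitSet Jm
  proper : (⋃ g ∈ G₀, ⇑g '' (B₁ ∪ Bm))ᶜ.Nonempty

/-- A letter of type `i` (`i = 0` for `G₁`, `i = 1` for `G₂`) for amalgamated free product
normal forms: an element of `G_{i+1} ∖ J`. -/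
def AFPLetter (G₁ G₂ J : Subgroup (M ≃ₜ M)) (i : Fin 2) (g : M ≃ₜ M) : Prop :=
  g ∈ (if i = 0 then G₁ else G₂) ∧ g ∉ J

/-- `h` is an `(i,j)`-form: a product of a nonempty alternating list of letters, whose first
letter lies in `G_i ∖ J` and whose last letter lies in `G_j ∖ J` (indices shifted so that
`0` stands for `G₁` and `1` for `G₂`). -/
def IsIJForm (G₁ G₂ J : Subgroup (M ≃ₜ M)) (i j : Fin 2) (h : M ≃ₜ M) : Prop :=
  ∃ l : List (M ≃ₜ M), l ≠ [] ∧ l.prod = h ∧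
    (∀ g ∈ l, AFPLetter G₁ G₂ J 0 g ∨ AFPLetter G₁ G₂ J 1 g) ∧
    l.Chain' (fun a b => ∀ c : Fin 2, AFPLetter G₁ G₂ J c a → AFPLetter G₁ G₂ J (1 - c) b) ∧
    (∀ hne : l ≠ [], AFPLetter G₁ G₂ J i (l.head hne)) ∧
    (∀ hne : l ≠ [], AFPLetter G₁ G₂ J j (l.getLast hne))

theorem exists_ne_ne {X : Type*} [Infinite X] (a b : X) : ∃ y : X, y ≠ a ∧ y ≠ b := by
  obtain ⟨y, hy⟩ := (Set.toFinite {a, b}).exists_notMem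
  simp only [Set.mem_insert_iff, Set.mem_singleton_iff, not_or] at hy
  exact ⟨y, hy⟩

theorem exists_injective_seq_mem {α : Type*} {S : Set α} (hS : S.Infinite) :
    ∃ g : ℕ → α, Function.Injective g ∧ ∀ n, g n ∈ S :=
  ⟨fun n => hS.natEmbedding S n, Subtype.val_injective.comp (hS.natEmbedding S).injective,
    fun n => (hS.natEmbedding S n).2⟩

section Dynamics

variable {X : Type*} [MetricSpace X]

theorem homeo_mul_apply (g k : X ≃ₜ X) (y : X) : (g * k) y = g (k y) := rfl

theorem homeo_one_apply (y : X) : (1 : X ≃ₜ X) y = y := rfl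

theorem homeo_inv_apply_self (g : X ≃ₜ X) (y : X) : g⁻¹ (g y) = y := g.symm_apply_apply y

theorem homeo_apply_inv_self (g : X ≃ₜ X) (y : X) : g (g⁻¹ y) = y := g.apply_symm_apply y

theorem homeo_inv_apply_eq_iff (g : X ≃ₜ X) {y z : X} : g⁻¹ y = z ↔ y = g z := by
  constructor
  · rintro rfl; exact (homeo_apply_inv_self g y).symm
  · rintro rfl; exact homeo_inv_apply_self g z

theorem IsConvSeq.comp_tendsto {g : ℕ → X ≃ₜ X} {zp zm : X} (hg : IsConvSeq g zp zm)
    {φ : ℕ → ℕ} (hφ : Tendsto φ atTop atTop) : IsConvSeq (g ∘ φ) zp zm :=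
  fun K hK hz U hU => hφ.eventually (hg K hK hz U hU)

theorem IsConvSeq.mul_left {g : ℕ → X ≃ₜ X} {zp zm : X} (hg : IsConvSeq g zp zm) (f : X ≃ₜ X) :
    IsConvSeq (fun k => f * g k) (f zp) zm := fun K hK hz U hU =>
  hg K hK hz (f ⁻¹' U) (f.continuous.continuousAt hU)

theorem exists_strictMono_injective {α : Type*} {f : ℕ → α} (hf : Tendsto f atTop cofinite) :
    ∃ φ : ℕ → ℕ, StrictMono φ ∧ Function.Injective (f ∘ φ) := by
  have hfin : ∀ a, {k | f k = a}.Finite := fun a => by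
    have h1 : ∀ᶠ k in atTop, f k ∈ ({a}ᶜ : Set α) := hf (Set.finite_singleton a).compl_mem_cofinite
    rw [← Nat.cofinite_eq_atTop, eventually_cofinite] at h1
    simpa using h1
  have key : ∀ s : Finset ℕ, (∀ x ∈ s, True) →
      ∃ y, True ∧ ∀ x ∈ s, x < y ∧ f x ≠ f y := by
    intro s _
    have h1 : ((⋃ x ∈ s, {k | f k = f x}) ∪ ⋃ x ∈ s, Set.Iic x : Set ℕ).Finite := by
      refine Set.Finite.union ?_ ?_
      · exact s.finite_toSet.biUnion fun x _ => hfin _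
      · exact s.finite_toSet.biUnion fun x _ => Set.finite_Iic _
    obtain ⟨y, hy⟩ := h1.exists_notMem
    refine ⟨y, trivial, fun x hx => ?_⟩
    simp only [Set.mem_union, Set.mem_iUnion, not_or, not_exists, Set.mem_ofPred_eq, Set.mem_Iic,
      not_le] at hy
    exact ⟨hy.2 x hx, fun h => hy.1 x hx h.symm⟩
  obtain ⟨φ, -, hφ⟩ := exists_seq_of_forall_finset_exists (fun _ => True)
    (fun x y => x < y ∧ f x ≠ f y) key
  refine ⟨φ, fun m n hmn => (hφ m n hmn).1, fun m n hmn => ?_⟩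
  rcases lt_trichotomy m n with h | h | h
  · exact absurd hmn (hφ m n h).2
  · exact h
  · exact absurd hmn.symm (hφ n m h).2

theorem exists_injective_of_infinite {α : Type*} {S : ℕ → Set α} (hS : ∀ k, (S k).Infinite) :
    ∃ (g : ℕ → α) (κ : ℕ → ℕ), Function.Injective g ∧ StrictMono κ ∧ ∀ n, g n ∈ S (κ n) := by
  classical
  have key : ∀ s : Finset (ℕ × α), (∀ x ∈ s, x.2 ∈ S x.1) →
      ∃ y : ℕ × α, y.2 ∈ S y.1 ∧ ∀ x ∈ s, x.1 < y.1 ∧ x.2 ≠ y.2 := by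
    intro s _
    obtain ⟨n, hn⟩ := (s.image Prod.fst).finite_toSet.bddAbove
    obtain ⟨a, ha, ha'⟩ := (hS (n + 1)).exists_notMem_finset (s.image Prod.snd)
    refine ⟨(n + 1, a), ha, fun x hx => ⟨?_, ?_⟩⟩
    · exact Nat.lt_succ_of_le (hn (by simpa using ⟨x.2, hx⟩))
    · rintro rfl
      exact ha' (Finset.mem_image_of_mem _ hx)
  obtain ⟨f, hf, hf'⟩ := exists_seq_of_forall_finset_exists (fun x : ℕ × α => x.2 ∈ S x.1)
    (fun x y => x.1 < y.1 ∧ x.2 ≠ y.2) key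
  refine ⟨fun n => (f n).2, fun n => (f n).1, fun m n hmn => ?_,
    fun m n hmn => (hf' m n hmn).1, hf⟩
  rcases lt_trichotomy m n with h | h | h
  · exact absurd hmn (hf' m n h).2
  · exact h
  · exact absurd hmn.symm (hf' n m h).2

theorem IsDiscreteConvGroup.exists_isConvSeq {G : Subgroup (X ≃ₜ X)} (hG : IsDiscreteConvGroup G)
    {f : ℕ → X ≃ₜ X} (hfG : ∀ k, f k ∈ G) (hf : Tendsto f atTop cofinite) :
    ∃ φ : ℕ → ℕ, StrictMono φ ∧ ∃ zp zm : X, IsConvSeq (f ∘ φ) zp zm := by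
  obtain ⟨φ, hφ, hinj⟩ := exists_strictMono_injective hf
  obtain ⟨ψ, hψ, zp, zm, h⟩ := hG (f ∘ φ) (fun k => hfG _) hinj
  exact ⟨φ ∘ ψ, hφ.comp hψ, zp, zm, h⟩

theorem IsDiscreteConvGroup.mono {G H : Subgroup (X ≃ₜ X)} (hG : IsDiscreteConvGroup G)
    (hHG : H ≤ G) : IsDiscreteConvGroup H :=
  fun g hg hinj => hG g (fun k => hHG (hg k)) hinj

theorem limitSet_mono {G H : Subgroup (X ≃ₜ X)} (hHG : H ≤ G) : limitSet H ⊆ limitSet G := by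
  rintro z ⟨g, hg, hinj, zm, h⟩
  exact ⟨g, fun k => hHG (hg k), hinj, zm, h⟩

theorem apply_mem_limitSet {G : Subgroup (X ≃ₜ X)} {g : X ≃ₜ X} (hg : g ∈ G) {z : X}
    (hz : z ∈ limitSet G) : g z ∈ limitSet G := by
  obtain ⟨f, hf, hinj, zm, h⟩ := hz
  exact ⟨fun k => g * f k, fun k => G.mul_mem hg (hf k),
    fun m n hmn => hinj (mul_left_cancel hmn), zm, h.mul_left g⟩

variable [CompactSpace X]

theorem IsConvSeq.eventually_mem {g : ℕ → X ≃ₜ X} {zp zm : X} (hg : IsConvSeq g zp zm)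
    {U V : Set X} (hU : U ∈ 𝓝 zp) (hV : V ∈ 𝓝 zm) : ∀ᶠ k in atTop, ∀ y, y ∉ V → g k y ∈ U := by
  filter_upwards [hg (interior V)ᶜ isOpen_interior.isClosed_compl.isCompact
    (by simpa using mem_interior_iff_mem_nhds.2 hV) U hU] with k hk y hy
  exact hk y fun h => hy (interior_subset h)

theorem IsConvSeq.tendsto {g : ℕ → X ≃ₜ X} {zp zm : X} (hg : IsConvSeq g zp zm)
    {u : ℕ → X} {y : X} (hu : Tendsto u atTop (𝓝 y)) (hy : y ≠ zm) :
    Tendsto (fun k => g k (u k)) atTop (𝓝 zp) := by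
  obtain ⟨A, B, hA, hB, hyA, hzB, hAB⟩ := t2_separation hy
  refine tendsto_iff_forall_eventually_mem.2 fun U hU => ?_
  filter_upwards [hg.eventually_mem hU (hB.mem_nhds hzB),
    hu.eventually_mem (hA.mem_nhds hyA)] with k hk hk'
  exact hk _ fun h => Set.disjoint_left.1 hAB hk' h

theorem IsConvSeq.tendsto_apply {g : ℕ → X ≃ₜ X} {zp zm : X} (hg : IsConvSeq g zp zm)
    {y : X} (hy : y ≠ zm) : Tendsto (fun k => g k y) atTop (𝓝 zp) :=
  hg.tendsto tendsto_const_nhds hy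

theorem IsConvSeq.inv {g : ℕ → X ≃ₜ X} {zp zm : X} (hg : IsConvSeq g zp zm) :
    IsConvSeq (fun k => (g k)⁻¹) zm zp := by
  intro K hK hz U hU
  filter_upwards [hg.eventually_mem (hK.isClosed.isOpen_compl.mem_nhds hz) hU] with k hk x hx
  by_contra h
  have := hk _ h
  rw [homeo_apply_inv_self] at this
  exact this hx

theorem IsConvSeq.exists_mem_ne [Infinite X] {g : ℕ → X ≃ₜ X} {zp zm : X} (hg : IsConvSeq g zp zm)
    {U : Set X} (hU : U ∈ 𝓝 zp) : ∃ y ∈ U, y ≠ zp := by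
  obtain ⟨y₁, h₁, -⟩ := exists_ne_ne zm zm
  obtain ⟨y₂, h₂, h₁₂⟩ := exists_ne_ne zm y₁
  obtain ⟨k, hk₁, hk₂⟩ := (((hg.tendsto_apply h₁).eventually_mem hU).and
    ((hg.tendsto_apply h₂).eventually_mem hU)).exists
  by_cases h : g k y₁ = zp
  · exact ⟨_, hk₂, fun h' => h₁₂ ((g k).injective (h'.trans h.symm))⟩
  · exact ⟨_, hk₁, h⟩

theorem exists_tendsto_subseq (u : ℕ → X) :
    ∃ (y : X) (φ : ℕ → ℕ), StrictMono φ ∧ Tendsto (u ∘ φ) atTop (𝓝 y) := by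
  obtain ⟨y, -, φ, hφ, h⟩ := isCompact_univ.tendsto_subseq (x := u) fun _ => Set.mem_univ _
  exact ⟨y, φ, hφ, h⟩

end Dynamics

section Triples

variable {X : Type*}

/-- At least two of the three points of `u` lie in `A`. -/
def Maj (u : Fin 3 → X) (A : Set X) : Prop := ∃ a b, a ≠ b ∧ u a ∈ A ∧ u b ∈ A

theorem Maj.mono {u : Fin 3 → X} {A B : Set X} (h : Maj u A) (hAB : A ⊆ B) : Maj u B := by
  obtain ⟨a, b, hab, ha, hb⟩ := h
  exact ⟨a, b, hab, hAB ha, hAB hb⟩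

theorem Maj.exists_mem_inter {u : Fin 3 → X} {A B : Set X} (hA : Maj u A) (hB : Maj u B) :
    ∃ a, u a ∈ A ∧ u a ∈ B := by
  obtain ⟨a, b, hab, ha, hb⟩ := hA
  obtain ⟨c, d, hcd, hc, hd⟩ := hB
  have : c = a ∨ c = b ∨ d = a ∨ d = b := by omega
  rcases this with rfl | rfl | rfl | rfl
  exacts [⟨_, ha, hc⟩, ⟨_, hb, hc⟩, ⟨_, ha, hd⟩, ⟨_, hb, hd⟩]

theorem maj_of_forall_ne {u : Fin 3 → X} (hu : Function.Injective u) {A : Set X} {p : X}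
    (h : ∀ a, u a ≠ p → u a ∈ A) : Maj u A := by
  by_cases h0 : u 0 = p
  · exact ⟨1, 2, by decide, h _ fun e => absurd (hu (e.trans h0.symm)) (by decide),
      h _ fun e => absurd (hu (e.trans h0.symm)) (by decide)⟩
  by_cases h1 : u 1 = p
  · exact ⟨0, 2, by decide, h _ h0,
      h _ fun e => absurd (hu (e.trans h1.symm)) (by decide)⟩
  · exact ⟨0, 1, by decide, h _ h0, h _ h1⟩

theorem maj_image_iff (g : X ≃ X) (u : Fin 3 → X) (A : Set X) :
    Maj (fun a => g (u a)) (g '' A) ↔ Maj u A := by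
  simp [Maj]

theorem exists_nhds_maj_compl [TopologicalSpace X] [T1Space X] {u : Fin 3 → X}
    (hu : Function.Injective u) (p : X) : ∃ U ∈ 𝓝 p, Maj u Uᶜ := by
  refine ⟨(Set.range u \ {p})ᶜ, ?_, ?_⟩
  · exact ((Set.finite_range u).subset Set.sdiff_subset).isClosed.isOpen_compl.mem_nhds (by simp)
  · exact maj_of_forall_ne hu (p := p) fun a ha => by simp [ha]

theorem exists_injective_triple [Infinite X] : ∃ u : Fin 3 → X, Function.Injective u :=
  ⟨fun a => Infinite.natEmbedding X a, fun a b h => by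
    have := (Infinite.natEmbedding X).injective h
    omega⟩

end Triples

section LimitSets

variable {X : Type*} [MetricSpace X] [CompactSpace X]

theorem IsConvSeq.eventually_maj {g : ℕ → X ≃ₜ X} {zp zm : X} (hg : IsConvSeq g zp zm)
    {u : Fin 3 → X} (hu : Function.Injective u) {U : Set X} (hU : U ∈ 𝓝 zp) :
    ∀ᶠ k in atTop, Maj (fun a => g k (u a)) U := by
  have h : ∀ a, ∀ᶠ k in atTop, u a ≠ zm → g k (u a) ∈ U := by
    intro a
    by_cases ha : u a = zm
    · simp [ha]
    · filter_upwards [(hg.tendsto_apply ha).eventually_mem hU] with k hk _ using hk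
  filter_upwards [eventually_all.2 h] with k hk
  exact maj_of_forall_ne ((g k).injective.comp hu) (p := g k zm)
    fun a ha => hk a fun e => ha (by simp [e])

theorem mem_limitSet_iff {G : Subgroup (X ≃ₜ X)} (hG : IsDiscreteConvGroup G)
    {θ : Fin 3 → X} (hθ : Function.Injective θ) {z : X} :
    z ∈ limitSet G ↔ ∀ U ∈ 𝓝 z, {g | g ∈ G ∧ Maj (fun a => g (θ a)) U}.Infinite := by
  constructor
  · rintro ⟨g, hgG, hinj, zm, h⟩ U hU
    obtain ⟨N, hN⟩ := eventually_atTop.1 (h.eventually_maj hθ hU)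
    refine Set.infinite_of_injective_forall_mem (f := fun n => g (n + N)) ?_ ?_
    · intro m n hmn
      have := hinj hmn
      omega
    · exact fun n => ⟨hgG _, hN _ (by omega)⟩
  · intro h
    obtain ⟨g, κ, hinj, hκ, hg⟩ := exists_injective_of_infinite
      (S := fun n : ℕ => {g | g ∈ G ∧ Maj (fun a => g (θ a)) (Metric.ball z (1 / ((n : ℝ) + 1)))})
      fun n => h _ (Metric.ball_mem_nhds z (by positivity))
    obtain ⟨φ, hφ, zp, zm, hc⟩ := hG g (fun k => (hg k).1) hinj
    refine ⟨g ∘ φ, fun k => (hg _).1, hinj.comp hφ.injective, zm, ?_⟩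
    suffices zp = z from this ▸ hc
    by_contra hne
    obtain ⟨U, V, hU, hV, hzU, hzV, hUV⟩ := t2_separation hne
    obtain ⟨r, hr, hrV⟩ := Metric.mem_nhds_iff.1 (hV.mem_nhds hzV)
    obtain ⟨N, hN⟩ := exists_nat_one_div_lt hr
    obtain ⟨k, hk, hkN⟩ := ((hc.eventually_maj hθ (hU.mem_nhds hzU)).and
      (eventually_ge_atTop N)).exists
    obtain ⟨a, ha, ha'⟩ := hk.exists_mem_inter (hg (φ k)).2
    refine Set.disjoint_left.1 hUV ha (hrV (Metric.ball_subset_ball ?_ ha'))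
    refine le_trans ?_ hN.le
    have : (N : ℝ) ≤ κ (φ k) := by
      exact_mod_cast hkN.trans ((hφ.le_apply).trans hκ.le_apply)
    gcongr

theorem isClosed_limitSet [Infinite X] {G : Subgroup (X ≃ₜ X)} (hG : IsDiscreteConvGroup G) :
    IsClosed (limitSet G) := by
  obtain ⟨θ, hθ⟩ := exists_injective_triple (X := X)
  refine isClosed_of_closure_subset fun z hz => ?_
  rw [mem_limitSet_iff hG hθ]
  intro U hU
  obtain ⟨w, hwU, hw⟩ := mem_closure_iff_nhds.1 hz (interior U) (interior_mem_nhds.2 hU)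
  exact ((mem_limitSet_iff hG hθ).1 hw _ (isOpen_interior.mem_nhds hwU)).mono
    fun g hg => ⟨hg.1, hg.2.mono interior_subset⟩

end LimitSets

section Conical

variable {X : Type*} [MetricSpace X]

theorem IsDiscreteConvGroup.limitSet_nonempty {H : Subgroup (X ≃ₜ X)}
    (hH : IsDiscreteConvGroup H) (hinf : (H : Set (X ≃ₜ X)).Infinite) :
    (limitSet H).Nonempty := by
  obtain ⟨g, hinj, hg⟩ := exists_injective_seq_mem hinf
  obtain ⟨φ, hφ, zp, zm, hc⟩ := hH g hg hinj
  exact ⟨zp, g ∘ φ, fun k => hg _, hinj.comp hφ.injective, zm, hc⟩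

variable [CompactSpace X]

/-- An element of a discrete convergence group whose only limit point is `x` cannot act with
north-south dynamics between disjoint sets, one of which contains the image of `x`. -/
theorem false_of_northSouth {H : Subgroup (X ≃ₜ X)} (hH : IsDiscreteConvGroup H) {x y : X}
    (hx : limitSet H ⊆ {x}) {p f : X ≃ₜ X} (hp : p ∈ H) {U V : Set X}
    (hU : IsOpen U) (hV : IsOpen V) (hUV : Disjoint U V) (hyU : y ∉ U) (hyV : y ∉ V)
    (hF : ∀ w ∉ V, (f * p * f⁻¹) w ∈ U) (hfx : f x ∈ U ∪ V) : False := by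
  have hF' : ∀ w ∉ U, (f * p⁻¹ * f⁻¹) w ∈ V := by
    intro w hw
    by_contra hv
    refine hw ?_
    have := hF _ hv
    simpa only [homeo_mul_apply, homeo_inv_apply_self, homeo_apply_inv_self] using this
  have hpow : ∀ i : ℕ, (f * p ^ (i + 1) * f⁻¹) y ∈ U := by
    intro i
    rw [← conj_pow]
    induction i with
    | zero => simpa using hF y hyV
    | succ i ih =>
      rw [pow_succ', homeo_mul_apply]
      exact hF _ (Set.disjoint_left.1 hUV ih)
  have hpow' : ∀ i : ℕ, (f * (p ^ (i + 1))⁻¹ * f⁻¹) y ∈ V := by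
    intro i
    rw [← inv_pow, ← conj_pow]
    induction i with
    | zero => simpa using hF' y hyU
    | succ i ih =>
      rw [pow_succ', homeo_mul_apply]
      exact hF' _ (Set.disjoint_right.1 hUV ih)
  have hord : ∀ i : ℕ, p ^ (i + 1) ≠ 1 := by
    intro i hi
    have := hpow i
    rw [hi, mul_one, mul_inv_cancel, homeo_one_apply] at this
    exact hyU this
  have hpinj : Function.Injective fun i : ℕ => p ^ (i + 1) := by
    have : ¬IsOfFinOrder p := by
      rw [isOfFinOrder_iff_pow_eq_one]
      rintro ⟨n, hn, h1⟩
      exact hord (n - 1) (by rwa [Nat.sub_add_cancel hn])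
    intro m n hmn
    exact Nat.succ_injective (injective_pow_iff_not_isOfFinOrder.2 this hmn)
  obtain ⟨φ, hφ, zp, zm, hc⟩ := hH _ (fun i => H.pow_mem hp (i + 1)) hpinj
  have hzp : zp = x := hx ⟨_, fun i => H.pow_mem hp (φ i + 1), hpinj.comp hφ.injective, zm, hc⟩
  have hzm : zm = x := hx ⟨_, fun i => H.inv_mem (H.pow_mem hp (φ i + 1)),
    inv_injective.comp (hpinj.comp hφ.injective), zp, hc.inv⟩
  have hne : f⁻¹ y ≠ x := by
    rw [Ne, homeo_inv_apply_eq_iff]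
    rintro rfl
    exact hfx.elim hyU hyV
  have h₁ : Tendsto (fun i => f ((p ^ (φ i + 1)) (f⁻¹ y))) atTop (𝓝 (f x)) :=
    (f.continuous.tendsto x).comp (hzp ▸ hc.tendsto_apply (hzm ▸ hne))
  have h₂ : Tendsto (fun i => f ((p ^ (φ i + 1))⁻¹ (f⁻¹ y))) atTop (𝓝 (f x)) :=
    (f.continuous.tendsto x).comp (hzm ▸ hc.inv.tendsto_apply (hzp ▸ hne))
  rcases hfx with hfx | hfx
  · obtain ⟨i, hi⟩ := (h₂.eventually_mem (hU.mem_nhds hfx)).exists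
    exact Set.disjoint_left.1 hUV hi (hpow' _)
  · obtain ⟨i, hi⟩ := (h₁.eventually_mem (hV.mem_nhds hfx)).exists
    exact Set.disjoint_left.1 hUV (hpow _) hi

/-- A conical limiting sequence for `x` in normal form: `h k` converges to the constant `b` away
from `x`, while `h k x` converges to a different point `a`. -/
structure ConicalSeq (G : Subgroup (X ≃ₜ X)) (h : ℕ → X ≃ₜ X) (x a b : X) : Prop where
  mem : ∀ k, h k ∈ G
  conv : IsConvSeq h b x
  lim : Tendsto (fun k => h k x) atTop (𝓝 a)
  ne : a ≠ b

/-- Elements of `H` conjugated by the conical sequence come arbitrarily close to fixing both `a`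
and `b`. -/
theorem ConicalSeq.infinite_conj {G H : Subgroup (X ≃ₜ X)} {h : ℕ → X ≃ₜ X} {x a b z : X}
    (hc : ConicalSeq G h x a b) (hinf : (H : Set (X ≃ₜ X)).Infinite)
    (hfix : ∀ p ∈ H, p x = x) (hz : z ≠ x) {ε : ℝ} (hε : 0 < ε) :
    {F : X ≃ₜ X | ∃ k, ∃ p ∈ H, F = h k * p * (h k)⁻¹ ∧ dist (h k x) a < ε ∧
      dist (h k z) b < ε ∧ dist (F (h k z)) b < ε}.Infinite := by
  classical
  intro hfin
  obtain ⟨P, hPH, hPcard⟩ := hinf.exists_subset_card_eq (hfin.toFinset.card + 1)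
  have hp : ∀ p ∈ P, ∀ᶠ k in atTop, dist (h k (p z)) b < ε := fun p hp =>
    (hc.conv.tendsto_apply fun e => hz (p.injective (e.trans (hfix p (hPH hp)).symm))
      ).eventually_mem
      (Metric.ball_mem_nhds b hε)
  obtain ⟨k, ⟨hk, hka⟩, hkb⟩ := ((((Finset.eventually_all P).2 hp).and
    (hc.lim.eventually_mem (Metric.ball_mem_nhds a hε))).and
    ((hc.conv.tendsto_apply hz).eventually_mem (Metric.ball_mem_nhds b hε))).exists
  have himg : P.image (fun p => h k * p * (h k)⁻¹) ⊆ hfin.toFinset := by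
    intro F hF
    obtain ⟨p, hp, rfl⟩ := Finset.mem_image.1 hF
    rw [Set.Finite.mem_toFinset]
    refine ⟨k, p, hPH hp, rfl, hka, hkb, ?_⟩
    simpa only [homeo_mul_apply, homeo_inv_apply_self] using hk p hp
  have hcard := Finset.card_le_card himg
  rw [Finset.card_image_of_injective _ (fun p q hpq => mul_left_cancel (mul_right_cancel hpq)),
    hPcard] at hcard
  omega

variable [Infinite X]

theorem exists_conicalSeq {G : Subgroup (X ≃ₜ X)} (hG : IsDiscreteConvGroup G) {h : ℕ → X ≃ₜ X}
    (hhG : ∀ k, h k ∈ G) (hinj : Function.Injective h) {x : X}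
    (hcon : ∀ z : X, z ≠ x → ∃ K : Set (X × X), IsCompact K ∧ (∀ p ∈ K, p.1 ≠ p.2) ∧
      ∀ k, (h k x, h k z) ∈ K) :
    ∃ φ : ℕ → ℕ, StrictMono φ ∧ ∃ a b : X, ConicalSeq G (h ∘ φ) x a b := by
  obtain ⟨φ, hφ, b, b', hc⟩ := hG h hhG hinj
  obtain ⟨a, ψ, hψ, ha⟩ := exists_tendsto_subseq fun k => h (φ k) x
  have hc' : IsConvSeq (h ∘ (φ ∘ ψ)) b b' := hc.comp_tendsto hψ.tendsto_atTop
  have key : ∀ y, y ≠ x → y ≠ b' → a ≠ b := by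
    intro y hy hy'
    obtain ⟨K, hK, hne, hmem⟩ := hcon y hy
    exact hne (a, b) (hK.isClosed.mem_of_tendsto (ha.prodMk_nhds (hc'.tendsto_apply hy'))
      (Eventually.of_forall fun k => hmem _))
  obtain ⟨y, hy, hy'⟩ := exists_ne_ne x b'
  have hab := key y hy hy'
  refine ⟨φ ∘ ψ, hφ.comp hψ, a, b, fun k => hhG _, ?_, ha, hab⟩
  suffices b' = x from this ▸ hc'
  by_contra hne
  exact hab (tendsto_nhds_unique ha (hc'.tendsto_apply fun e => hne e.symm))

/-- A conical limit point of `G` is not the only limit point of an infinite subgroup. -/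
theorem ConicalSeq.not_limitSet_subset {G H : Subgroup (X ≃ₜ X)} (hG : IsDiscreteConvGroup G)
    {h : ℕ → X ≃ₜ X} {x a b : X} (hc : ConicalSeq G h x a b) (hHG : H ≤ G)
    (hinf : (H : Set (X ≃ₜ X)).Infinite) : ¬limitSet H ⊆ {x} := by
  intro hx
  have hH := hG.mono hHG
  have hxH : x ∈ limitSet H := by
    obtain ⟨w, hw⟩ := hH.limitSet_nonempty hinf
    rwa [← (hx hw : w = x)]
  have hfix : ∀ p ∈ H, p x = x := fun p hp => hx (apply_mem_limitSet hp hxH)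
  obtain ⟨z, hz, -⟩ := exists_ne_ne x x
  obtain ⟨F, κ, hFinj, hκ, hF⟩ := exists_injective_of_infinite fun n : ℕ =>
    hc.infinite_conj hinf hfix hz (ε := 1 / ((n : ℝ) + 1)) (by positivity)
  choose k p hpH hFk hka hkb hFb using hF
  have hFG : ∀ n, F n ∈ G := fun n => by
    rw [hFk]
    exact G.mul_mem (G.mul_mem (hc.mem _) (hHG (hpH n))) (G.inv_mem (hc.mem _))
  obtain ⟨φ, hφ, α, β, hcF⟩ := hG F hFG hFinj
  have hzero : Tendsto (fun n => 1 / ((κ (φ n) : ℝ) + 1)) atTop (𝓝 0) :=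
    tendsto_one_div_add_atTop_nhds_zero_nat.comp (hκ.comp hφ).tendsto_atTop
  have lim_of : ∀ {u : ℕ → X} {w : X}, (∀ n, dist (u n) w < 1 / ((κ n : ℝ) + 1)) →
      Tendsto (fun n => u (φ n)) atTop (𝓝 w) := fun hu =>
    tendsto_iff_dist_tendsto_zero.2
      (squeeze_zero (fun _ => dist_nonneg) (fun n => (hu (φ n)).le) hzero)
  have hla := lim_of hka
  have hlb := lim_of hkb
  have hlF := lim_of hFb
  have hFfix : ∀ n, F n (h (k n) x) = h (k n) x := fun n => by
    rw [hFk, homeo_mul_apply, homeo_mul_apply, homeo_inv_apply_self, hfix _ (hpH n)]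
  have hα : a ≠ β → α = a := fun hne => by
    have := hcF.tendsto hla hne
    simp only [Function.comp_apply, hFfix] at this
    exact tendsto_nhds_unique this hla
  have hα' : b ≠ β → α = b := fun hne => tendsto_nhds_unique (hcF.tendsto hlb hne) hlF
  have hcase : (α = a ∧ β = b) ∨ (α = b ∧ β = a) := by
    by_cases h₁ : a = β
    · exact Or.inr ⟨hα' fun h₂ => hc.ne (h₁.trans h₂.symm), h₁.symm⟩
    · refine Or.inl ⟨hα h₁, ?_⟩
      by_contra h₂
      exact hc.ne ((hα h₁).symm.trans (hα' (Ne.symm h₂)))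
  have hαβ : α ≠ β := by
    rcases hcase with ⟨rfl, rfl⟩ | ⟨rfl, rfl⟩
    exacts [hc.ne, hc.ne.symm]
  obtain ⟨y, hyα, hyβ⟩ := exists_ne_ne α β
  obtain ⟨U, V, hU, hV, hαU, hβV, hUV⟩ := t2_separation hαβ
  have hU' : IsOpen (U \ {y}) := hU.sdiff isClosed_singleton
  have hV' : IsOpen (V \ {y}) := hV.sdiff isClosed_singleton
  have hαU' : U \ {y} ∈ 𝓝 α := hU'.mem_nhds ⟨hαU, hyα.symm⟩
  have hβV' : V \ {y} ∈ 𝓝 β := hV'.mem_nhds ⟨hβV, hyβ.symm⟩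
  have hnear : (U \ {y}) ∪ (V \ {y}) ∈ 𝓝 a := by
    rcases hcase with ⟨rfl, rfl⟩ | ⟨rfl, rfl⟩
    exacts [mem_of_superset hαU' Set.subset_union_left,
      mem_of_superset hβV' Set.subset_union_right]
  obtain ⟨n, hn, hn'⟩ := ((hcF.eventually_mem hαU' hβV').and (hla.eventually_mem hnear)).exists
  refine false_of_northSouth hH hx (hpH (φ n)) hU' hV'
    (hUV.mono Set.sdiff_subset Set.sdiff_subset) (y := y) (by simp) (by simp)
    (f := h (k (φ n))) (fun w hw => ?_) hn'
  rw [← hFk]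
  exact hn w hw

end Conical

section Walls

variable {X : Type*} [MetricSpace X]

theorem IsDiscreteConvGroup.finite_maj_image [CompactSpace X] {J : Subgroup (X ≃ₜ X)}
    (hJ : IsDiscreteConvGroup J) {θ : Fin 3 → X} (hθ : Function.Injective θ) {lo hi : Set X}
    (hlo : IsClosed lo) (hhi : IsClosed hi) (hd : Disjoint lo hi) {ε : ℝ} (hε : 0 < ε) :
    {g : X ≃ₜ X | g ∈ J ∧ Maj θ (g '' lo) ∧ ∃ y ∈ hi, ∃ y' ∈ hi, ε ≤ dist (g y) (g y')}.Finite := by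
  by_contra hinf
  obtain ⟨g, hinj, hmem⟩ := exists_injective_seq_mem hinf
  obtain ⟨φ, hφ, zp, zm, hc⟩ := hJ g (fun k => (hmem k).1) hinj
  by_cases hzm : zm ∈ lo
  · have h₁ := hc hi hhi.isCompact (Set.disjoint_left.1 hd hzm) _
      (Metric.ball_mem_nhds zp (half_pos hε))
    obtain ⟨k, hk⟩ := h₁.exists
    obtain ⟨-, -, y, hy, y', hy', hyy'⟩ := hmem (φ k)
    have := dist_triangle_right (g (φ k) y) (g (φ k) y') zp
    have h₂ : dist (g (φ k) y) zp < ε / 2 := hk y hy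
    have h₃ : dist (g (φ k) y') zp < ε / 2 := hk y' hy'
    linarith
  · obtain ⟨k, hk⟩ := (hc.inv.eventually_maj hθ (hlo.isOpen_compl.mem_nhds hzm)).exists
    obtain ⟨a, ha, v, hv, hva⟩ := hk.exists_mem_inter
      ((maj_image_iff (g (φ k))⁻¹.toEquiv _ _).2 (hmem (φ k)).2.1)
    obtain ⟨v, hv, rfl⟩ := hv
    have hva : (g (φ k))⁻¹ (g (φ k) v) = (g (φ k))⁻¹ (θ a) := hva
    rw [homeo_inv_apply_self] at hva
    exact ha (hva ▸ hv)

/-- A `J`-invariant system of walls `(D.1, D.2)` between disjoint sets, fine enough to separate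
points from closed sets and discrete enough for only finitely many walls to lie between `θ` and
two points at a given distance. -/
structure WallSystem (J : Subgroup (X ≃ₜ X)) (θ : Fin 3 → X) (W : Set (Set X × Set X)) :
    Prop where
  image_mem : ∀ g ∈ J, ∀ D ∈ W, (g '' D.1, g '' D.2) ∈ W
  finite : ∀ ε > 0, {D | D ∈ W ∧ Maj θ D.1 ∧ ∃ y ∈ D.2, ∃ y' ∈ D.2, ε ≤ dist y y'}.Finite
  separating : ∀ d, ∀ U ∈ 𝓝 d, ∃ D ∈ W, Uᶜ ⊆ D.1 ∧ D.2 ∈ 𝓝 d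
  disjoint : ∀ D ∈ W, Disjoint D.1 D.2

theorem IsDiscreteConvGroup.exists_wall_radius [CompactSpace X] {J : Subgroup (X ≃ₜ X)}
    (hJ : IsDiscreteConvGroup J) {θ : Fin 3 → X} (hθ : Function.Injective θ) {ε : ℝ}
    (hε : 0 < ε) (d : X) :
    ∃ δ, 0 < δ ∧ δ < ε ∧ ∀ g ∈ J, Maj θ (g '' (Metric.ball d ε)ᶜ) →
      ∀ y ∈ Metric.closedBall d δ, ∀ y' ∈ Metric.closedBall d δ, dist (g y) (g y') < ε := by
  have hdisj : Disjoint (Metric.ball d ε)ᶜ (Metric.closedBall d (ε / 2)) :=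
    Set.disjoint_left.2 fun y hy hy' => hy (Metric.closedBall_subset_ball (by linarith) hy')
  have hfin := hJ.finite_maj_image hθ Metric.isOpen_ball.isClosed_compl
    Metric.isClosed_closedBall hdisj hε
  have hev : ∀ᶠ y in 𝓝 d, ∀ g ∈ hfin.toFinset, dist (g y) (g d) < ε / 2 :=
    (Finset.eventually_all _).2 fun g _ =>
      (g.continuous.tendsto d).eventually_mem (Metric.ball_mem_nhds _ (half_pos hε))
  obtain ⟨r, hr, hball⟩ := Metric.mem_nhds_iff.1 hev
  refine ⟨min (ε / 2) (r / 2), by positivity, (min_le_left _ _).trans_lt (by linarith), ?_⟩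
  intro g hg hmaj y hy y' hy'
  by_contra hlt
  have hgF : g ∈ hfin.toFinset := by
    rw [Set.Finite.mem_toFinset]
    exact ⟨hg, hmaj, y, Metric.closedBall_subset_closedBall (min_le_left _ _) hy, y',
      Metric.closedBall_subset_closedBall (min_le_left _ _) hy', not_lt.1 hlt⟩
  have hsub : Metric.closedBall d (min (ε / 2) (r / 2)) ⊆ Metric.ball d r :=
    Metric.closedBall_subset_ball ((min_le_right _ _).trans_lt (by linarith))
  have h₁ := hball (hsub hy) g hgF
  have h₂ := hball (hsub hy') g hgF
  have := dist_triangle_right (g y) (g y') (g d)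
  exact hlt (by linarith)

theorem IsDiscreteConvGroup.exists_wallSystem [CompactSpace X] {J : Subgroup (X ≃ₜ X)}
    (hJ : IsDiscreteConvGroup J) {θ : Fin 3 → X} (hθ : Function.Injective θ) :
    ∃ W, WallSystem J θ W := by
  have hpos : ∀ n : ℕ, (0 : ℝ) < 1 / ((n : ℝ) + 1) := fun n => by positivity
  choose δ hδ hδε hδJ using fun n : ℕ => hJ.exists_wall_radius hθ (hpos n)
  have hcover : ∀ n, ∃ t : Finset X, ∀ y, ∃ d ∈ t, y ∈ Metric.ball d (δ n d) := by
    intro n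
    obtain ⟨t, -, ht⟩ := isCompact_univ.elim_nhds_subcover (fun d => Metric.ball d (δ n d))
      fun d _ => Metric.ball_mem_nhds d (hδ n d)
    exact ⟨t, fun y => by simpa using ht (Set.mem_univ y)⟩
  choose t ht using hcover
  have hdisj : ∀ (n : ℕ) d, Disjoint (Metric.ball d (1 / ((n : ℝ) + 1)))ᶜ
      (Metric.closedBall d (δ n d)) := fun n d =>
    Set.disjoint_left.2 fun y hy hy' => hy (Metric.closedBall_subset_ball (hδε n d) hy')
  refine ⟨{D | ∃ g ∈ J, ∃ n, ∃ d ∈ t n, D = (g '' (Metric.ball d (1 / ((n : ℝ) + 1)))ᶜ,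
    g '' Metric.closedBall d (δ n d))}, ?_, ?_, ?_, ?_⟩
  · rintro g hg _ ⟨g', hg', n, d, hd, rfl⟩
    refine ⟨g * g', J.mul_mem hg hg', n, d, hd, ?_⟩
    simp only [Prod.mk.injEq, Set.image_image]
    exact ⟨rfl, rfl⟩
  · intro ε hε
    obtain ⟨N, hN⟩ := exists_nat_one_div_lt hε
    have hfin := fun n d => hJ.finite_maj_image hθ Metric.isOpen_ball.isClosed_compl
      Metric.isClosed_closedBall (hdisj n d) hε
    refine ((Finset.range N).finite_toSet.biUnion fun n _ => (t n).finite_toSet.biUnion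
      fun d _ => (hfin n d).image fun g : X ≃ₜ X => (g '' (Metric.ball d (1 / ((n : ℝ) + 1)))ᶜ,
        g '' Metric.closedBall d (δ n d))).subset ?_
    rintro _ ⟨⟨g, hg, n, d, hd, rfl⟩, hmaj, _, ⟨y, hy, rfl⟩, _, ⟨y', hy', rfl⟩, hyy'⟩
    have hn : n ∈ Finset.range N := by
      rw [Finset.mem_range]
      by_contra hn
      have h₁ := hδJ n d g hg hmaj y hy y' hy'
      have h₂ : 1 / ((n : ℝ) + 1) ≤ 1 / ((N : ℝ) + 1) := by
        have : (N : ℝ) ≤ n := by exact_mod_cast not_lt.1 hn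
        gcongr
      linarith
    simp only [Set.mem_iUnion]
    exact ⟨n, hn, d, hd, g, ⟨hg, hmaj, y, hy, y', hy', hyy'⟩, rfl⟩
  · intro d U hU
    obtain ⟨r, hr, hrU⟩ := Metric.mem_nhds_iff.1 hU
    obtain ⟨n, hn⟩ := exists_nat_one_div_lt (half_pos hr)
    obtain ⟨c, hc, hdc⟩ := ht n d
    refine ⟨_, ⟨1, J.one_mem, n, c, hc, rfl⟩, ?_, ?_⟩
    · intro w hw
      refine ⟨w, fun hwc => hw (hrU ?_), rfl⟩
      have h₁ := dist_triangle_right w d c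
      have h₂ := hδε n c
      rw [Metric.mem_ball] at hwc hdc ⊢
      linarith
    · have : (1 : X ≃ₜ X) '' Metric.closedBall c (δ n c) = Metric.closedBall c (δ n c) :=
        Set.image_id _
      rw [this]
      exact mem_of_superset (Metric.isOpen_ball.mem_nhds hdc) Metric.ball_subset_closedBall
  · rintro _ ⟨g, hg, n, d, hd, rfl⟩
    exact (Set.disjoint_image_iff g.injective).2 (hdisj n d)

/-- The wall `D` lies strictly in front of the wall `E`. -/
def WallLt (D E : Set X × Set X) : Prop := D.2ᶜ ⊆ E.1 ∧ (D.2 ∩ E.1).Nonempty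

/-- `S` is a chain of walls of `W`, each of which separates most of `u` from most of `v`. -/
structure WallChain (W : Set (Set X × Set X)) (u v : Fin 3 → X) (S : Finset (Set X × Set X)) :
    Prop where
  mem : ∀ D ∈ S, D ∈ W
  chain : IsChain WallLt (S : Set (Set X × Set X))
  fst : ∀ D ∈ S, Maj u D.1
  snd : ∀ D ∈ S, Maj v D.2

/-- The largest cardinality of a chain of walls between `u` and `v`. -/
noncomputable def wallDist (W : Set (Set X × Set X)) (u v : Fin 3 → X) : ℕ :=
  sSup {n | ∃ S, WallChain W u v S ∧ S.card = n}

theorem WallSystem.not_wallLt_self {J : Subgroup (X ≃ₜ X)} {θ : Fin 3 → X}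
    {W : Set (Set X × Set X)} (hW : WallSystem J θ W) {D : Set X × Set X} (hD : D ∈ W) :
    ¬WallLt D D := fun h => by
  obtain ⟨y, hy₂, hy₁⟩ := h.2
  exact Set.disjoint_left.1 (hW.disjoint D hD) hy₁ hy₂

theorem WallSystem.bddAbove {J : Subgroup (X ≃ₜ X)} {θ : Fin 3 → X}
    {W : Set (Set X × Set X)} (hW : WallSystem J θ W) {v : Fin 3 → X}
    (hv : Function.Injective v) : BddAbove {n | ∃ S, WallChain W θ v S ∧ S.card = n} := by
  obtain ⟨ε, hε, hvε⟩ : ∃ ε > 0, ∀ a b, a ≠ b → ε ≤ dist (v a) (v b) := by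
    obtain ⟨p, hpp, hp⟩ := Finset.exists_min_image (Finset.univ.filter fun p : Fin 3 × Fin 3 =>
      p.1 ≠ p.2) (fun p => dist (v p.1) (v p.2)) ⟨(0, 1), by simp⟩
    exact ⟨_, dist_pos.2 (hv.ne (Finset.mem_filter.1 hpp).2),
      fun a b hab => hp (a, b) (by simpa using hab)⟩
  refine ⟨(hW.finite ε hε).toFinset.card, ?_⟩
  rintro _ ⟨S, hS, rfl⟩
  refine Finset.card_le_card fun D hD => ?_
  rw [Set.Finite.mem_toFinset]
  obtain ⟨a, b, hab, ha, hb⟩ := hS.snd D hD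
  exact ⟨hS.mem D hD, hS.fst D hD, _, ha, _, hb, hvε a b hab⟩

theorem WallSystem.exists_card_eq {J : Subgroup (X ≃ₜ X)} {θ : Fin 3 → X}
    {W : Set (Set X × Set X)} (hW : WallSystem J θ W) {v : Fin 3 → X}
    (hv : Function.Injective v) : ∃ S, WallChain W θ v S ∧ S.card = wallDist W θ v :=
  Nat.sSup_mem (s := {n | ∃ S, WallChain W θ v S ∧ S.card = n})
    ⟨0, ∅, ⟨by simp, by simp, by simp, by simp⟩, rfl⟩ (hW.bddAbove hv)

theorem WallSystem.exists_deep_chain {J : Subgroup (X ≃ₜ X)} {θ : Fin 3 → X}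
    (hθ : Function.Injective θ) {W : Set (Set X × Set X)} (hW : WallSystem J θ W) {d : X}
    (hd : ∀ U ∈ 𝓝 d, ∃ y ∈ U, y ≠ d) (N : ℕ) :
    ∃ S : Finset (Set X × Set X), S.card = N ∧ IsChain WallLt (S : Set (Set X × Set X)) ∧
      ∀ D ∈ S, D ∈ W ∧ Maj θ D.1 ∧ D.2 ∈ 𝓝 d := by
  classical
  induction N with
  | zero => exact ⟨∅, rfl, by simp, by simp⟩
  | succ N ih =>
    obtain ⟨S, hcard, hchain, hS⟩ := ih
    obtain ⟨U₀, hU₀, hθU₀⟩ := exists_nhds_maj_compl hθ d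
    have hU₁ : (⋂ D ∈ S, D.2) ∩ U₀ ∈ 𝓝 d :=
      inter_mem ((Filter.biInter_finset_mem S).2 fun D hD => (hS D hD).2.2) hU₀
    obtain ⟨y, hyU, hyd⟩ := hd _ hU₁
    obtain ⟨E, hE, hUE, hEd⟩ := hW.separating d (((⋂ D ∈ S, D.2) ∩ U₀) \ {y})
      (sdiff_mem hU₁ (isClosed_singleton.isOpen_compl.mem_nhds hyd.symm))
    have hlt : ∀ D ∈ S, WallLt D E := fun D hD =>
      ⟨fun w hw => hUE fun h => hw (Set.mem_iInter₂.1 h.1.1 D hD),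
        y, Set.mem_iInter₂.1 hyU.1 D hD, hUE (by simp)⟩
    have hES : E ∉ S := fun h => hW.not_wallLt_self hE (hlt E h)
    refine ⟨insert E S, by rw [Finset.card_insert_of_notMem hES, hcard], ?_, ?_⟩
    · rw [Finset.coe_insert]
      exact hchain.insert fun D hD _ => Or.inr (hlt D hD)
    · intro D hD
      rcases Finset.mem_insert.1 hD with rfl | hD
      · exact ⟨hE, hθU₀.mono fun w hw => hUE fun h => hw h.1.2, hEd⟩
      · exact hS D hD

theorem WallChain.card_filter_le {W : Set (Set X × Set X)} {θ w : Fin 3 → X}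
    {S : Finset (Set X × Set X)} (hS : WallChain W θ w S) {V W' : Set X} {ε : ℝ}
    (hVW : ∀ y ∈ V, ∀ y' ∈ W', ε ≤ dist y y') (hw : Maj w W')
    (hfin : {D | D ∈ W ∧ Maj θ D.1 ∧ ∃ y ∈ D.2, ∃ y' ∈ D.2, ε ≤ dist y y'}.Finite)
    [DecidablePred fun D : Set X × Set X => ¬V ⊆ D.1] :
    (S.filter fun D => ¬V ⊆ D.1).card ≤ hfin.toFinset.card + 1 := by
  classical
  have key : ∀ D ∈ S, ∀ E ∈ S, ¬V ⊆ E.1 → WallLt D E → D ∈ hfin.toFinset := by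
    intro D hD E hE hVE hlt
    rw [Set.Finite.mem_toFinset]
    obtain ⟨v, hv, hvE⟩ := Set.not_subset.1 hVE
    obtain ⟨v', hvD, -⟩ := hlt.2
    refine ⟨hS.mem D hD, hS.fst D hD, v, by_contra fun h => hvE (hlt.1 h), ?_⟩
    obtain ⟨a, ha, ha'⟩ := (hS.snd D hD).exists_mem_inter hw
    exact ⟨_, ha, hVW v hv _ ha'⟩
  have h₁ : ((S.filter fun D => ¬V ⊆ D.1) \ hfin.toFinset).card ≤ 1 := by
    rw [Finset.card_le_one]
    intro D hD E hE
    simp only [Finset.mem_sdiff, Finset.mem_filter] at hD hE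
    by_contra hne
    rcases hS.chain hD.1.1 hE.1.1 hne with h | h
    · exact hD.2 (key D hD.1.1 E hE.1.1 hE.1.2 h)
    · exact hE.2 (key E hE.1.1 D hD.1.1 hD.1.2 h)
  have h₂ := Finset.card_le_card_sdiff_add_card (t := hfin.toFinset)
    (s := S.filter fun D => ¬V ⊆ D.1)
  omega

/-- Applying the inverse of a far element `j n` of a convergence sequence with attracting point
`b'` to a triple close to a point `a' ≠ b'` increases its wall distance from `θ`. -/
theorem WallSystem.eventually_wallDist_lt [CompactSpace X] {J : Subgroup (X ≃ₜ X)}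
    {θ : Fin 3 → X}
    (hθ : Function.Injective θ) {W : Set (Set X × Set X)} (hW : WallSystem J θ W) {d a' b' : X}
    (hd : ∀ U ∈ 𝓝 d, ∃ y ∈ U, y ≠ d) (hab : a' ≠ b') {j : ℕ → X ≃ₜ X} (hj : ∀ n, j n ∈ J)
    (hc : IsConvSeq j b' d) :
    ∃ A ∈ 𝓝 a', ∀ᶠ n in atTop, ∀ w : Fin 3 → X, Function.Injective w → Maj w A →
      wallDist W θ w < wallDist W θ fun i => (j n)⁻¹ (w i) := by
  classical
  obtain ⟨V₀, hV₀, hθV₀⟩ := exists_nhds_maj_compl hθ b'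
  have hpos : 0 < dist a' b' / 4 := by have := dist_pos.2 hab; positivity
  set ε := dist a' b' / 4 with hε
  set V := V₀ ∩ Metric.ball b' ε with hV
  have hVb : V ∈ 𝓝 b' := inter_mem hV₀ (Metric.ball_mem_nhds _ hpos)
  have hVA : ∀ y ∈ V, ∀ y' ∈ Metric.ball a' ε, ε ≤ dist y y' := by
    intro y hy y' hy'
    have h₁ : dist y b' < ε := hy.2
    have h₂ : dist y' a' < ε := hy'
    have h₃ := dist_triangle4_left a' b' y' y
    rw [dist_comm y' y, dist_comm] at h₃
    have h₄ := dist_triangle4 a' y' y b'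
    rw [dist_comm a' y', dist_comm y' y] at h₄
    linarith
  obtain ⟨S, hcard, hchain, hS⟩ :=
    hW.exists_deep_chain hθ hd ((hW.finite ε hpos).toFinset.card + 2)
  have hSd : (⋂ D ∈ S, D.2) ∈ 𝓝 d :=
    (Filter.biInter_finset_mem S).2 fun D hD => (hS D hD).2.2
  refine ⟨Metric.ball a' ε, Metric.ball_mem_nhds _ hpos, ?_⟩
  filter_upwards [hc.inv.eventually_mem hSd hVb, hc.eventually_maj hθ hVb] with n hn hmajn w hw hwA
  obtain ⟨R, hR, hRcard⟩ := hW.exists_card_eq hw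
  have hbad := hR.card_filter_le hVA hwA (hW.finite ε hpos)
  have hsplit := Finset.card_filter_add_card_filter_not (s := R) fun D => V ⊆ D.1
  have hAV : ∀ y ∈ Metric.ball a' ε, y ∉ V := fun y hy hyV => by
    have := hVA y hyV y hy
    rw [dist_self] at this
    linarith
  set im : Set X × Set X → Set X × Set X := fun D =>
    (⇑(j n)⁻¹ '' D.1, ⇑(j n)⁻¹ '' D.2) with him
  have him_inj : Function.Injective im := fun D E h => by
    have h₁ := (Prod.mk.inj h).1
    have h₂ := (Prod.mk.inj h).2
    exact Prod.ext (Set.image_injective.2 (j n)⁻¹.injective h₁)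
      (Set.image_injective.2 (j n)⁻¹.injective h₂)
  set R' := (R.filter fun D => V ⊆ D.1).image im with hR'
  have hlt : ∀ D ∈ S, ∀ E ∈ R', WallLt D E := by
    intro D hD E hE
    obtain ⟨B, hB, rfl⟩ := Finset.mem_image.1 hE
    rw [Finset.mem_filter] at hB
    refine ⟨fun y hy => ⟨j n y, hB.2 (by_contra fun h => ?_), homeo_inv_apply_self _ _⟩, ?_⟩
    · have := hn _ h
      rw [homeo_inv_apply_self] at this
      exact hy (Set.mem_iInter₂.1 this D hD)
    · obtain ⟨a, ha, ha'⟩ := hθV₀.exists_mem_inter (hR.fst B hB.1)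
      exact ⟨(j n)⁻¹ (θ a), Set.mem_iInter₂.1 (hn _ fun h => ha h.1) D hD, _, ha', rfl⟩
  have hR'W : ∀ E ∈ R', E ∈ W := by
    intro E hE
    obtain ⟨B, hB, rfl⟩ := Finset.mem_image.1 hE
    exact hW.image_mem _ (J.inv_mem (hj n)) B (hR.mem B (Finset.mem_filter.1 hB).1)
  have hdisj : Disjoint S R' := Finset.disjoint_left.2 fun D hD hD' =>
    hW.not_wallLt_self (hS D hD).1 (hlt D hD D hD')
  have hR'chain : IsChain WallLt (R' : Set (Set X × Set X)) := by
    intro E hE F hF hne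
    obtain ⟨B, hB, rfl⟩ := Finset.mem_image.1 hE
    obtain ⟨C, hC, rfl⟩ := Finset.mem_image.1 hF
    have hmap : ∀ {B C : Set X × Set X}, WallLt B C → WallLt (im B) (im C) := by
      rintro B C ⟨h₁, h₂⟩
      refine ⟨?_, ?_⟩
      · simp only [him]
        rw [← Set.image_compl_eq (j n)⁻¹.bijective]
        exact Set.image_mono h₁
      · simp only [him]
        rw [← Set.image_inter (j n)⁻¹.injective]
        exact h₂.image _
    exact (hR.chain (Finset.mem_filter.1 hB).1 (Finset.mem_filter.1 hC).1
      fun e => hne (e ▸ rfl)).imp hmap hmap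
  have hchain' : WallChain W θ (fun i => (j n)⁻¹ (w i)) (S ∪ R') := by
    refine ⟨fun D hD => ?_, ?_, fun D hD => ?_, fun D hD => ?_⟩
    · exact (Finset.mem_union.1 hD).elim (fun h => (hS D h).1) (hR'W D)
    · intro D hD E hE hne
      rcases Finset.mem_union.1 hD with hD | hD <;> rcases Finset.mem_union.1 hE with hE | hE
      · exact hchain hD hE hne
      · exact Or.inl (hlt D hD E hE)
      · exact Or.inr (hlt E hE D hD)
      · exact hR'chain hD hE hne
    · rcases Finset.mem_union.1 hD with hD | hD
      · exact (hS D hD).2.1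
      · obtain ⟨B, hB, rfl⟩ := Finset.mem_image.1 hD
        obtain ⟨a, b, hab, ha, hb⟩ := hmajn
        exact ⟨a, b, hab, ⟨_, (Finset.mem_filter.1 hB).2 ha, homeo_inv_apply_self _ _⟩,
          ⟨_, (Finset.mem_filter.1 hB).2 hb, homeo_inv_apply_self _ _⟩⟩
    · rcases Finset.mem_union.1 hD with hD | hD
      · obtain ⟨a, b, hab, ha, hb⟩ := hwA
        exact ⟨a, b, hab, Set.mem_iInter₂.1 (hn _ (hAV _ ha)) D hD,
          Set.mem_iInter₂.1 (hn _ (hAV _ hb)) D hD⟩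
      · obtain ⟨B, hB, rfl⟩ := Finset.mem_image.1 hD
        exact (maj_image_iff (j n)⁻¹.toEquiv w B.2).2 (hR.snd B (Finset.mem_filter.1 hB).1)
  have hle : (S ∪ R').card ≤ wallDist W θ fun i => (j n)⁻¹ (w i) :=
    le_csSup (hW.bddAbove ((j n)⁻¹.injective.comp hw)) ⟨_, hchain', rfl⟩
  rw [Finset.card_union_of_disjoint hdisj, hcard, Finset.card_image_of_injective _ him_inj] at hle
  omega

end Walls

section AlternatingForms

variable {A : Type*} [Group A] {Γ : Bool → Subgroup A} {J : Subgroup A}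

/-- `AltForm Γ J i j g`: the element `g` is an alternating product of elements of `Γ false ∖ J` and
`Γ true ∖ J`, the first factor lying in `Γ i` and the last one in `Γ j`. -/
inductive AltForm (Γ : Bool → Subgroup A) (J : Subgroup A) : Bool → Bool → A → Prop
  | base {i : Bool} {g : A} (hg : g ∈ Γ i) (hgJ : g ∉ J) : AltForm Γ J i i g
  | step {i j : Bool} {g g' : A} (hg : g ∈ Γ i) (hgJ : g ∉ J) (h : AltForm Γ J (!i) j g') :
      AltForm Γ J i j (g * g')

theorem AltForm.subgroup_mul (hle : ∀ i, J ≤ Γ i) {i j : Bool} {c g : A} (hc : c ∈ J)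
    (h : AltForm Γ J i j g) : AltForm Γ J i j (c * g) := by
  cases h with
  | base hg hgJ =>
    exact .base ((Γ _).mul_mem (hle _ hc) hg) fun h => hgJ ((J.mul_mem_cancel_left hc).1 h)
  | step hg hgJ h =>
    rw [← mul_assoc]
    exact .step ((Γ _).mul_mem (hle _ hc) hg) (fun h => hgJ ((J.mul_mem_cancel_left hc).1 h)) h

theorem AltForm.snoc {i j : Bool} {b g : A} (h : AltForm Γ J i j g) (hb : b ∈ Γ (!j))
    (hbJ : b ∉ J) : AltForm Γ J i (!j) (g * b) := by
  induction h with
  | base hg hgJ => exact .step hg hgJ (.base hb hbJ)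
  | step hg hgJ h ih =>
    rw [mul_assoc]
    exact .step hg hgJ (ih hb)

theorem AltForm.inv {i j : Bool} {g : A} (h : AltForm Γ J i j g) : AltForm Γ J j i g⁻¹ := by
  induction h with
  | base hg hgJ => exact .base ((Γ _).inv_mem hg) fun h => hgJ (J.inv_mem_iff.1 h)
  | @step i j g g' hg hgJ h ih =>
    rw [mul_inv_rev]
    have := ih.snoc (b := g⁻¹) (by simpa using hg) (fun h => hgJ (J.inv_mem_iff.1 h))
    simpa using this

theorem AltForm.mul_subgroup (hle : ∀ i, J ≤ Γ i) {i j : Bool} {c g : A} (hc : c ∈ J)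
    (h : AltForm Γ J i j g) : AltForm Γ J i j (g * c) := by
  simpa using (h.inv.subgroup_mul hle (J.inv_mem hc)).inv

theorem AltForm.exists_last {i j : Bool} {g : A} (h : AltForm Γ J i j g) :
    ∃ w ∈ Γ j, ∀ w' ∈ Γ j, w' ∉ J → AltForm Γ J i j (g * w⁻¹ * w') := by
  induction h with
  | base hg hgJ => exact ⟨_, hg, fun w' hw' hw'J => by simpa using .base hw' hw'J⟩
  | step hg hgJ h ih =>
    obtain ⟨w, hw, hw'⟩ := ih
    refine ⟨w, hw, fun w' h₁ h₂ => ?_⟩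
    simpa only [mul_assoc] using AltForm.step hg hgJ (hw' w' h₁ h₂)

theorem AltForm.mul_left (hle : ∀ i, J ≤ Γ i) {i i' j : Bool} {c g : A} (hc : c ∈ Γ i)
    (h : AltForm Γ J i' j g) : c * g ∈ J ∨ ∃ i'', AltForm Γ J i'' j (c * g) := by
  by_cases hcJ : c ∈ J
  · exact Or.inr ⟨_, h.subgroup_mul hle hcJ⟩
  cases h with
  | base hg hgJ =>
    rcases eq_or_ne i' i with rfl | hne
    · by_cases hm : c * g ∈ J
      · exact Or.inl hm
      · exact Or.inr ⟨_, .base ((Γ _).mul_mem hc hg) hm⟩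
    · obtain rfl : i' = !i := Bool.eq_not_of_ne hne
      exact Or.inr ⟨_, .step hc hcJ (.base hg hgJ)⟩
  | @step _ _ a g' hg hgJ h =>
    rcases eq_or_ne i' i with rfl | hne
    · rw [← mul_assoc]
      by_cases hm : c * a ∈ J
      · exact Or.inr ⟨_, h.subgroup_mul hle hm⟩
      · exact Or.inr ⟨_, .step ((Γ _).mul_mem hc hg) hm h⟩
    · obtain rfl : i' = !i := Bool.eq_not_of_ne hne
      exact Or.inr ⟨_, .step hc hcJ (.step hg hgJ h)⟩

theorem mem_or_exists_altForm (hle : ∀ i, J ≤ Γ i) {g : A} (hg : g ∈ Γ false ⊔ Γ true) :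
    g ∈ J ∨ ∃ i j, AltForm Γ J i j g := by
  have key : ∀ i, ∀ c ∈ Γ i, ∀ g, (g ∈ J ∨ ∃ i j, AltForm Γ J i j g) →
      (c * g ∈ J ∨ ∃ i j, AltForm Γ J i j (c * g)) := by
    rintro i c hc g (hg | ⟨i', j, hg⟩)
    · by_cases hcJ : c * g ∈ J
      · exact Or.inl hcJ
      · exact Or.inr ⟨_, _, .base ((Γ i).mul_mem hc (hle i hg)) hcJ⟩
    · exact (hg.mul_left hle hc).imp_right fun ⟨i'', h⟩ => ⟨i'', j, h⟩
  rw [Subgroup.sup_eq_closure] at hg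
  induction hg using Subgroup.closure_induction_left with
  | one => exact Or.inl J.one_mem
  | mul_left c hc g hg ih => exact hc.elim (fun h => key _ c h g ih) (fun h => key _ c h g ih)
  | inv_mul_cancel c hc g hg ih =>
    exact hc.elim (fun h => key _ _ ((Γ _).inv_mem h) g ih)
      (fun h => key _ _ ((Γ _).inv_mem h) g ih)

/-- Stripping a factor in `Γ i` from the right. -/
theorem mem_or_exists_altForm_mul_inv (hle : ∀ i, J ≤ Γ i) {g : A} (hg : g ∈ Γ false ⊔ Γ true)
    (i : Bool) : g ∈ Γ i ∨ ∃ c ∈ Γ i, ∃ i', AltForm Γ J i' (!i) (g * c⁻¹) := by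
  rcases mem_or_exists_altForm hle hg with hg | ⟨i', j, hg⟩
  · exact Or.inl (hle i hg)
  rcases eq_or_ne j i with rfl | hne
  · have hinv := hg.inv
    generalize hk : g⁻¹ = k at hinv
    cases hinv with
    | base h _ => exact Or.inl (by rw [← hk] at h; simpa using h)
    | @step _ _ a g' ha haJ h =>
      refine Or.inr ⟨a⁻¹, (Γ _).inv_mem ha, i', ?_⟩
      have : g * a⁻¹⁻¹ = g'⁻¹ := by
        rw [inv_inv, ← inv_inv g, hk]
        group
      rw [this]
      exact h.inv
  · obtain rfl : j = !i := Bool.eq_not_of_ne hne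
    exact Or.inr ⟨1, (Γ i).one_mem, i', by simpa using hg⟩

end AlternatingForms

section PingPong

variable {X : Type*} [MetricSpace X]

/-- Ping-pong position of `Γ false` and `Γ true` with respect to `J`, witnessed by closed sets
`B false` and `B true`, each of which is disjoint from the interior of the other. -/
structure PingPong (Γ : Bool → Subgroup (X ≃ₜ X)) (J : Subgroup (X ≃ₜ X)) (B : Bool → Set X) :
    Prop where
  isClosed : ∀ i, IsClosed (B i)
  int_nonempty : ∀ i, (interior (B i)).Nonempty
  disjoint : ∀ i, Disjoint (interior (B i)) (B (!i))
  inv : ∀ i, ∀ j ∈ J, ∀ y ∈ B i, j y ∈ B i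
  maps : ∀ i, ∀ g ∈ Γ i, g ∉ J → ∀ y ∈ B i, g y ∈ interior (B (!i))
  lim : ∀ i, limitSet (Γ i) \ limitSet J ⊆ interior (B (!i))
  le : ∀ i, J ≤ Γ i
  proper : ∀ i, ∃ g ∈ Γ i, g ∉ J

variable {Γ : Bool → Subgroup (X ≃ₜ X)} {J : Subgroup (X ≃ₜ X)} {B : Bool → Set X}

theorem PingPong.exists_first (hP : PingPong Γ J B) {i j : Bool} {g : X ≃ₜ X}
    (hg : AltForm Γ J i j g) : ∃ a ∈ Γ i, a ∉ J ∧ ∀ y ∈ B j, ∃ y' ∈ B i, g y = a y' := by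
  induction hg with
  | base hg hgJ => exact ⟨_, hg, hgJ, fun y hy => ⟨y, hy, rfl⟩⟩
  | @step i j g g' hg hgJ h ih =>
    obtain ⟨a, ha, haJ, hmap⟩ := ih
    refine ⟨g, hg, hgJ, fun y hy => ⟨g' y, ?_, rfl⟩⟩
    obtain ⟨y', hy', h'⟩ := hmap y hy
    rw [h']
    simpa using interior_subset (hP.maps _ a ha haJ y' hy')

theorem PingPong.altForm_maps (hP : PingPong Γ J B) {i j : Bool} {g : X ≃ₜ X}
    (hg : AltForm Γ J i j g) {y : X} (hy : y ∈ B j) : g y ∈ interior (B (!i)) := by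
  obtain ⟨a, ha, haJ, hmap⟩ := hP.exists_first hg
  obtain ⟨y', hy', h'⟩ := hmap y hy
  rw [h']
  exact hP.maps i a ha haJ y' hy'

theorem PingPong.not_frequently_altForm_self (hP : PingPong Γ J B) {γ : ℕ → X ≃ₜ X}
    (hγ : ∀ y, Tendsto (fun k => γ k y) atTop (𝓝 y)) (i : Bool) :
    ¬∃ᶠ k in atTop, AltForm Γ J i i (γ k) := by
  intro hf
  obtain ⟨y, hy⟩ := hP.int_nonempty i
  obtain ⟨k, hk, hk'⟩ := (hf.and_eventually
    ((hγ y).eventually_mem (isOpen_interior.mem_nhds hy))).exists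
  refine Set.disjoint_left.1 (hP.disjoint (!i)) (hP.altForm_maps hk (interior_subset hy)) ?_
  simpa using interior_subset hk'

theorem PingPong.mul_inv_mem_of_frequently (hP : PingPong Γ J B) {γ : ℕ → X ≃ₜ X}
    (hγ : ∀ y, Tendsto (fun k => γ k y) atTop (𝓝 y)) {i : Bool}
    (hf : ∃ᶠ k in atTop, AltForm Γ J i (!i) (γ k)) {α β : X ≃ₜ X} (hα : α ∈ Γ (!i)) (hαJ : α ∉ J)
    (hβ : β ∈ Γ (!i)) (hβJ : β ∉ J) : α * β⁻¹ ∈ J := by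
  have hconj : ∀ δ : X ≃ₜ X, ∀ᶠ k in atTop, ¬AltForm Γ J (!i) (!i) (δ * γ k * δ⁻¹) := fun δ =>
    not_frequently.1 (hP.not_frequently_altForm_self (γ := fun k => δ * γ k * δ⁻¹) (fun y => by
      have := (δ.continuous.tendsto _).comp (hγ (δ⁻¹ y))
      rwa [homeo_apply_inv_self] at this) _)
  obtain ⟨k, hk, hk₁, hk₂⟩ := (hf.and_eventually ((hconj α).and (hconj β))).exists
  obtain ⟨w, hw, hw'⟩ := hk.exists_last
  have key : ∀ δ ∈ Γ (!i), δ ∉ J → ¬AltForm Γ J (!i) (!i) (δ * γ k * δ⁻¹) → w * δ⁻¹ ∈ J := by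
    intro δ hδ hδJ hδf
    by_contra hm
    have := hw' _ ((Γ (!i)).mul_mem hw ((Γ (!i)).inv_mem hδ)) hm
    have h₂ : AltForm Γ J (!i) (!i) (δ * (γ k * w⁻¹ * (w * δ⁻¹))) :=
      .step hδ hδJ (by simpa using this)
    refine hδf ?_
    convert h₂ using 1
    group
  have := J.mul_mem (J.inv_mem (key α hα hαJ hk₁)) (key β hβ hβJ hk₂)
  simpa [mul_assoc] using this

theorem PingPong.subset_interior_of_frequently (hP : PingPong Γ J B) {γ : ℕ → X ≃ₜ X}
    (hγ : ∀ y, Tendsto (fun k => γ k y) atTop (𝓝 y)) {i : Bool}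
    (hf : ∃ᶠ k in atTop, AltForm Γ J i (!i) (γ k))
    (hind : ∀ α ∈ Γ i, α ∉ J → ∀ β ∈ Γ i, β ∉ J → α * β⁻¹ ∈ J) : B (!i) ⊆ interior (B (!i)) := by
  intro y hy
  obtain ⟨α, hα, hαJ⟩ := hP.proper i
  have hclosed : IsClosed (α '' B i) := α.isClosedMap _ (hP.isClosed i)
  have hmem : ∃ᶠ k in atTop, γ k y ∈ α '' B i := by
    refine hf.mono fun k hk => ?_
    obtain ⟨a, ha, haJ, hmap⟩ := hP.exists_first hk
    obtain ⟨y', hy', h'⟩ := hmap y hy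
    have := hind α⁻¹ ((Γ i).inv_mem hα) (fun h => hαJ (J.inv_mem_iff.1 h)) a⁻¹
      ((Γ i).inv_mem ha) (fun h => haJ (J.inv_mem_iff.1 h))
    refine ⟨_, hP.inv i _ this y' hy', ?_⟩
    rw [h', inv_inv, homeo_mul_apply, homeo_apply_inv_self]
  obtain ⟨y', hy', rfl⟩ := hclosed.mem_of_frequently_of_tendsto hmem (hγ y)
  exact hP.maps i α hα hαJ y' hy'

theorem PingPong.limitSet_subset [CompactSpace X] [Infinite X] (hP : PingPong Γ J B) (i : Bool) :
    limitSet J ⊆ B i := by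
  rintro z ⟨g, hg, hinj, zm, hc⟩
  obtain ⟨y, hy, hne⟩ : ∃ y ∈ B i, y ≠ zm := by
    obtain ⟨y, hy⟩ := hP.int_nonempty i
    by_cases h : y = zm
    · exact hc.inv.exists_mem_ne (mem_interior_iff_mem_nhds.1 (h ▸ hy))
    · exact ⟨y, interior_subset hy, h⟩
  exact (hP.isClosed i).mem_of_tendsto (hc.tendsto_apply hne)
    (Eventually.of_forall fun k => hP.inv i _ (hg k) y hy)

theorem PingPong.false_of_tendsto_id [CompactSpace X] [Infinite X] (hP : PingPong Γ J B)
    (hJ : IsDiscreteConvGroup J)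
    {i₀ : Bool} (hinf : (Γ i₀ : Set (X ≃ₜ X)).Infinite) {γ : ℕ → X ≃ₜ X}
    (hγ : ∀ y, Tendsto (fun k => γ k y) atTop (𝓝 y))
    (hγ' : ∀ y, Tendsto (fun k => (γ k)⁻¹ y) atTop (𝓝 y))
    (hmem : ∀ k, γ k ∈ Γ false ⊔ Γ true) (hnot : ∀ k, γ k ∉ J) : False := by
  obtain ⟨i, j, hf⟩ : ∃ i j, ∃ᶠ k in atTop, AltForm Γ J i j (γ k) := by
    by_contra hne
    push Not at hne
    obtain ⟨k, hk⟩ := (eventually_all.2 fun i => eventually_all.2 fun j => hne i j).exists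
    obtain ⟨i, j, h⟩ := (mem_or_exists_altForm hP.le (hmem k)).resolve_left (hnot k)
    exact hk i j h
  rcases eq_or_ne j i with rfl | hne
  · exact hP.not_frequently_altForm_self hγ j hf
  obtain rfl : j = !i := Bool.eq_not_of_ne hne
  have hf' : ∃ᶠ k in atTop, AltForm Γ J (!i) (!!i) (γ k)⁻¹ :=
    hf.mono fun k hk => by simpa using hk.inv
  have h₁ : ∀ α ∈ Γ (!i), α ∉ J → ∀ β ∈ Γ (!i), β ∉ J → α * β⁻¹ ∈ J :=
    fun α hα hαJ β hβ hβJ => hP.mul_inv_mem_of_frequently hγ hf hα hαJ hβ hβJ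
  have h₂ : ∀ α ∈ Γ i, α ∉ J → ∀ β ∈ Γ i, β ∉ J → α * β⁻¹ ∈ J :=
    fun α hα hαJ β hβ hβJ => hP.mul_inv_mem_of_frequently hγ' hf' (by simpa) hαJ (by simpa) hβJ
  have h₃ : ∀ l, ∀ α ∈ Γ l, α ∉ J → ∀ β ∈ Γ l, β ∉ J → α * β⁻¹ ∈ J := by
    intro l
    rcases eq_or_ne l i with rfl | hl
    · exact h₂
    · obtain rfl : l = !i := Bool.eq_not_of_ne hl
      exact h₁
  have hJinf : (J : Set (X ≃ₜ X)).Infinite := by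
    intro hfin
    obtain ⟨β, hβ, hβJ⟩ := hP.proper i₀
    refine hinf ((hfin.union (hfin.image fun c => c * β)).subset fun α hα => ?_)
    by_cases hαJ : α ∈ J
    · exact Or.inl hαJ
    · exact Or.inr ⟨α * β⁻¹, h₃ _ α hα hαJ β hβ hβJ, by simp⟩
  have hsub : B (!i) ⊆ interior (B (!i)) := hP.subset_interior_of_frequently hγ hf (h₃ i)
  obtain ⟨y, hy⟩ := hJ.limitSet_nonempty hJinf
  exact Set.disjoint_left.1 (hP.disjoint (!i)) (hsub (hP.limitSet_subset _ hy))
    (hP.limitSet_subset _ hy)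

theorem TendstoHomeo.tendsto_inv [CompactSpace X] {g : ℕ → X ≃ₜ X} {h : X ≃ₜ X}
    (hg : Tendsto (fun k => toCM (g k)) atTop (𝓝 (toCM h))) {w : ℕ → X} {y : X}
    (hw : Tendsto w atTop (𝓝 (h y))) : Tendsto (fun k => (g k)⁻¹ (w k)) atTop (𝓝 y) := by
  have hu := ContinuousMap.tendsto_iff_tendstoUniformly.1 hg
  have hd : Tendsto (fun k => dist (h ((g k)⁻¹ (w k))) (w k)) atTop (𝓝 0) := by
    rw [Metric.tendsto_atTop]
    intro ε hε
    obtain ⟨N, hN⟩ := eventually_atTop.1 (Metric.tendstoUniformly_iff.1 hu ε hε)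
    refine ⟨N, fun k hk => ?_⟩
    have : dist (h ((g k)⁻¹ (w k))) (g k ((g k)⁻¹ (w k))) < ε := hN k hk ((g k)⁻¹ (w k))
    rw [homeo_apply_inv_self] at this
    simpa using this
  have hlim : Tendsto (fun k => h ((g k)⁻¹ (w k))) atTop (𝓝 (h y)) :=
    (tendsto_iff_of_dist hd).2 hw
  have := (h⁻¹.continuous.tendsto _).comp hlim
  simpa only [Function.comp_def, homeo_inv_apply_self] using this

theorem TendstoHomeo.tendsto_apply [CompactSpace X] {g : ℕ → X ≃ₜ X} {h : X ≃ₜ X}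
    (hg : Tendsto (fun k => toCM (g k)) atTop (𝓝 (toCM h))) (y : X) :
    Tendsto (fun k => g k y) atTop (𝓝 (h y)) :=
  (ContinuousMap.tendsto_iff_tendstoUniformly.1 hg).tendsto_at y

/-- A convergence group generated by two groups in ping-pong position is discrete. -/
theorem PingPong.isDiscreteConvGroup [CompactSpace X] [Infinite X] (hP : PingPong Γ J B)
    (hJ : IsDiscreteConvGroup J) {i₀ : Bool} (hinf : (Γ i₀ : Set (X ≃ₜ X)).Infinite)
    (hconv : IsConvGroup (Γ false ⊔ Γ true)) : IsDiscreteConvGroup (Γ false ⊔ Γ true) := by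
  intro f hf hinj
  obtain ⟨φ, hφ, ⟨h, hh⟩ | hc⟩ := hconv f hf hinj
  swap
  · exact ⟨φ, hφ, hc⟩
  exfalso
  set g := f ∘ φ with hg
  have hginj : Function.Injective g := hinj.comp hφ.injective
  have hgmem : ∀ k, g k ∈ Γ false ⊔ Γ true := fun k => hf _
  have hlarge : ∀ c : X ≃ₜ X, ¬∃ᶠ k in atTop, c⁻¹ * g k ∈ J := by
    intro c hfr
    obtain ⟨ψ, hψ, hψJ⟩ := extraction_of_frequently_atTop hfr
    obtain ⟨χ, hχ, zp, zm, hcs⟩ := hJ _ hψJ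
      fun m n hmn => hψ.injective (hginj (mul_left_cancel hmn))
    have hval : ∀ y, y ≠ zm → c⁻¹ (h y) = zp := fun y hy => by
      have h₁ : Tendsto (fun k => g (ψ (χ k)) y) atTop (𝓝 (h y)) :=
        (TendstoHomeo.tendsto_apply hh y).comp (hψ.comp hχ).tendsto_atTop
      exact tendsto_nhds_unique ((c⁻¹.continuous.tendsto _).comp h₁) (hcs.tendsto_apply hy)
    obtain ⟨y₁, hy₁, -⟩ := exists_ne_ne zm zm
    obtain ⟨y₂, hy₂, hne⟩ := exists_ne_ne zm y₁
    exact hne (h.injective (c⁻¹.injective ((hval _ hy₂).trans (hval _ hy₁).symm)))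
  have hex : ∀ k, ∃ l, k ≤ l ∧ (g k)⁻¹ * g l ∉ J := fun k =>
    ((eventually_ge_atTop k).and (not_frequently.1 (hlarge (g k)))).exists
  choose l hl hlJ using hex
  have hl' : Tendsto l atTop atTop := tendsto_atTop_mono hl tendsto_id
  have hhl : Tendsto (fun k => toCM (g (l k))) atTop (𝓝 (toCM h)) := hh.comp hl'
  refine hP.false_of_tendsto_id hJ hinf (γ := fun k => (g k)⁻¹ * g (l k)) (fun y => ?_)
    (fun y => ?_) (fun k => mul_mem (inv_mem (hgmem k)) (hgmem _)) hlJ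
  · exact TendstoHomeo.tendsto_inv hh (TendstoHomeo.tendsto_apply hhl y)
  · have := TendstoHomeo.tendsto_inv hhl (TendstoHomeo.tendsto_apply hh y)
    simp only [mul_inv_rev, inv_inv]
    exact this

end PingPong

section Parabolic

variable {X : Type*} [MetricSpace X]

theorem IsParabolicElem.infinite_zpowers {p : X ≃ₜ X} (hp : IsParabolicElem p) :
    (Subgroup.zpowers p : Set (X ≃ₜ X)).Infinite := by
  intro hfin
  have hfin' : (Set.range fun n : ℤ => toCM (p ^ n)).Finite := by
    refine (hfin.image toCM).subset ?_
    rintro _ ⟨n, rfl⟩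
    exact ⟨p ^ n, ⟨n, rfl⟩, rfl⟩
  refine hp.1 ⟨?_, ?_⟩
  · rw [hfin'.isClosed.closure_eq]
    exact hfin'.isCompact
  · rw [hfin'.isClosed.closure_eq]
    rintro _ ⟨n, rfl⟩
    exact ⟨_, rfl⟩

theorem IsParabolicElem.limitSet_zpowers_subset [CompactSpace X] [Infinite X] {p : X ≃ₜ X} {d : X}
    (hp : IsParabolicElem p) (hd : p d = d) : limitSet (Subgroup.zpowers p) ⊆ {d} := by
  rintro z ⟨g, hg, hinj, zm, hc⟩
  obtain ⟨y, hy, hy'⟩ := exists_ne_ne zm (p⁻¹ zm)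
  have h₁ : Tendsto (fun k => p (g k y)) atTop (𝓝 (p z)) :=
    (p.continuous.tendsto z).comp (hc.tendsto_apply hy)
  have h₂ : Tendsto (fun k => g k (p y)) atTop (𝓝 z) :=
    hc.tendsto_apply fun e => hy' ((homeo_inv_apply_eq_iff p).2 e.symm).symm
  have h₃ : ∀ k, p (g k y) = g k (p y) := fun k => by
    obtain ⟨n, hn⟩ := hg k
    rw [← hn, ← homeo_mul_apply, ← homeo_mul_apply]
    exact congrArg (fun q : X ≃ₜ X => q y) ((mul_self_zpow p n).trans (mul_zpow_self p n).symm)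
  simp only [h₃] at h₁
  exact hp.2.unique (tendsto_nhds_unique h₁ h₂) hd

theorem IsParabolicPt.not_conicalSeq [CompactSpace X] [Infinite X] {G H : Subgroup (X ≃ₜ X)}
    (hG : IsDiscreteConvGroup G) (hHG : H ≤ G) {d : X} (hd : IsParabolicPt H d)
    {h : ℕ → X ≃ₜ X} {a b : X} : ¬ConicalSeq G h d a b := fun hc => by
  obtain ⟨p, hpH, hp, hpd⟩ := hd
  exact hc.not_limitSet_subset hG ((Subgroup.zpowers_le).2 (hHG hpH)) hp.infinite_zpowers
    (hp.limitSet_zpowers_subset hpd)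

end Parabolic

section MinimalSequences

variable {X : Type*} [MetricSpace X]

/-- A sequence in `G` leaving every left coset of `Γ i`, whose members minimize the wall distance
in their left coset of `J` and push points `u k`, `v k` of the limit set of `Γ i` towards
different points. -/
structure MinSeq (Γ : Bool → Subgroup (X ≃ₜ X)) (J : Subgroup (X ≃ₜ X)) (i : Bool)
    (W : Set (Set X × Set X)) (θ : Fin 3 → X) (f : ℕ → X ≃ₜ X) (u v : ℕ → X) (a b : X) :
    Prop where
  form : ∀ k, ∃ l, AltForm Γ J l (!i) (f k)
  mem : ∀ k, f k ∈ Γ false ⊔ Γ true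
  min : ∀ k, ∀ j ∈ J,
    wallDist W θ (fun l => (f k)⁻¹ (θ l)) ≤ wallDist W θ fun l => j ((f k)⁻¹ (θ l))
  leaves : ∀ g, ∀ᶠ k in atTop, (f k)⁻¹ * g ∉ Γ i
  fst_mem : ∀ k, u k ∈ limitSet (Γ i)
  snd_mem : ∀ k, v k ∈ limitSet (Γ i)
  fst_lim : Tendsto (fun k => f k (u k)) atTop (𝓝 a)
  snd_lim : Tendsto (fun k => f k (v k)) atTop (𝓝 b)
  ne : a ≠ b

variable {Γ : Bool → Subgroup (X ≃ₜ X)} {J : Subgroup (X ≃ₜ X)} {B : Bool → Set X} {i : Bool}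
  {W : Set (Set X × Set X)} {θ : Fin 3 → X} {f : ℕ → X ≃ₜ X} {u v : ℕ → X} {a b : X}

theorem MinSeq.comp (hf : MinSeq Γ J i W θ f u v a b) {φ : ℕ → ℕ} (hφ : StrictMono φ) :
    MinSeq Γ J i W θ (f ∘ φ) (u ∘ φ) (v ∘ φ) a b where
  form _ := hf.form _
  mem _ := hf.mem _
  min _ := hf.min _
  leaves g := hφ.tendsto_atTop.eventually (hf.leaves g)
  fst_mem _ := hf.fst_mem _
  snd_mem _ := hf.snd_mem _
  fst_lim := hf.fst_lim.comp hφ.tendsto_atTop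
  snd_lim := hf.snd_lim.comp hφ.tendsto_atTop
  ne := hf.ne

theorem MinSeq.tendsto_cofinite (hf : MinSeq Γ J i W θ f u v a b) {q : ℕ → X ≃ₜ X}
    (hq : ∀ k, q k ∈ Γ i) : Tendsto (fun k => f k * q k) atTop cofinite := by
  refine tendsto_iff_forall_eventually_mem.2 fun s hs => ?_
  have hfin : sᶜ.Finite := hs
  filter_upwards [(eventually_all_finite hfin).2 fun g _ => hf.leaves g] with k hk
  by_contra hmem
  refine hk _ hmem ?_
  rw [inv_mul_cancel_left]
  exact hq k

variable [CompactSpace X]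

theorem isConvSeq_of_fixed_parabolic {G : Subgroup (X ≃ₜ X)} {d α β : X}
    (hd : ∀ (h : ℕ → X ≃ₜ X) (a b : X), ¬ConicalSeq G h d a b) {q : ℕ → X ≃ₜ X}
    (hqG : ∀ k, q k ∈ G) (hqd : ∀ k, q k d = d) (hc : IsConvSeq q α β) : α = d ∧ β = d := by
  have hlim : Tendsto (fun k => q k d) atTop (𝓝 d) := by simp [hqd]
  have hlim' : Tendsto (fun k => (q k)⁻¹ d) atTop (𝓝 d) := by
    simp [(homeo_inv_apply_eq_iff _).2 (hqd _).symm]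
  have h₁ : d ≠ β → α = d := fun hne => tendsto_nhds_unique (hc.tendsto_apply hne) hlim
  by_cases hα : α = d
  · refine ⟨hα, by_contra fun hβ => ?_⟩
    exact hd _ d β ⟨fun k => G.inv_mem (hqG k), hα ▸ hc.inv, hlim', fun e => hβ e.symm⟩
  · have hβ : β = d := by_contra fun hβ => hα (h₁ fun e => hβ e.symm)
    exact absurd ⟨hqG, hβ ▸ hc, hlim, fun e => hα e.symm⟩ (hd q d α)

variable [Infinite X]

theorem MinSeq.repelling_mem (hP : PingPong Γ J B) (hf : MinSeq Γ J i W θ f u v a b) {c d : X}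
    (hc : IsConvSeq f c d) : d ∈ B i := by
  by_contra hd
  have hy : ∀ l, ∃ y ∈ B l, y ≠ c := fun l => by
    obtain ⟨y, hy⟩ := hP.int_nonempty l
    by_cases h : y = c
    · exact hc.exists_mem_ne (mem_interior_iff_mem_nhds.1 (h ▸ hy))
    · exact ⟨y, interior_subset hy, h⟩
  choose y hyB hyc using hy
  obtain ⟨k, hk⟩ := (eventually_all.2 fun l => (hc.inv.tendsto_apply (hyc l)).eventually_mem
    ((hP.isClosed i).isOpen_compl.mem_nhds hd)).exists
  obtain ⟨l, hl⟩ := hf.form k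
  refine hk l (interior_subset ?_)
  simpa using hP.altForm_maps hl.inv (hyB l)

theorem MinSeq.repelling_mem_limitSet (hΓ : IsDiscreteConvGroup (Γ i))
    (hf : MinSeq Γ J i W θ f u v a b) {c d : X} (hc : IsConvSeq f c d) :
    d ∈ limitSet (Γ i) := by
  by_contra hd
  have hV := (isClosed_limitSet hΓ).isOpen_compl.mem_nhds hd
  have key : ∀ {w : ℕ → X}, (∀ k, w k ∈ limitSet (Γ i)) →
      Tendsto (fun k => f k (w k)) atTop (𝓝 c) := fun hw =>
    tendsto_iff_forall_eventually_mem.2 fun U hU => by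
      filter_upwards [hc.eventually_mem hU hV] with k hk
      exact hk _ fun h => h (hw k)
  exact hf.ne ((tendsto_nhds_unique hf.fst_lim (key hf.fst_mem)).trans
    (tendsto_nhds_unique (key hf.snd_mem) hf.snd_lim))

theorem MinSeq.repelling_not_conical (hW : WallSystem J θ W) (hθ : Function.Injective θ)
    (hf : MinSeq Γ J i W θ f u v a b) {c d : X} (hc : IsConvSeq f c d) {j : ℕ → X ≃ₜ X}
    {a' b' : X} : ¬ConicalSeq J j d a' b' := fun hj => by
  obtain ⟨A, hA, hev⟩ := hW.eventually_wallDist_lt hθ (fun U hU => hc.inv.exists_mem_ne hU)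
    hj.ne hj.mem hj.conv
  obtain ⟨A', hA'A, hA', ha'⟩ := mem_nhds_iff.1 hA
  obtain ⟨n, hn, hnA⟩ := (hev.and (hj.lim.eventually_mem (hA'.mem_nhds ha'))).exists
  obtain ⟨k, hk⟩ := ((hc.inv.mul_left (j n)).eventually_maj hθ (hA'.mem_nhds hnA)).exists
  have hlt := hn _ (((j n * (f k)⁻¹).injective).comp hθ) (hk.mono hA'A)
  simp only [Function.comp_apply, homeo_mul_apply, homeo_inv_apply_self] at hlt
  exact absurd (hf.min k _ (hj.mem n)) (not_le.2 hlt)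

theorem PingPong.stabilizer_le (hP : PingPong Γ J B) {d : X} (hd : d ∈ limitSet J) {g : X ≃ₜ X}
    (hg : g ∈ Γ false ⊔ Γ true) (hgd : g d = d) : g ∈ J := by
  refine (mem_or_exists_altForm hP.le hg).resolve_right ?_
  rintro ⟨l, m, hform⟩
  have := hP.altForm_maps hform (hP.limitSet_subset m hd)
  rw [hgd] at this
  exact Set.disjoint_left.1 (hP.disjoint (!l)) this (hP.limitSet_subset _ hd)

theorem MinSeq.repelling_not_parabolic (hP : PingPong Γ J B) (hW : WallSystem J θ W)
    (hθ : Function.Injective θ) (hG : IsDiscreteConvGroup (Γ false ⊔ Γ true))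
    (hΓG : Γ i ≤ Γ false ⊔ Γ true)
    (hf : MinSeq Γ J i W θ f u v a b) {c d : X} (hc : IsConvSeq f c d) (hdJ : d ∈ limitSet J)
    (hd : IsParabolicPt J d) : ¬IsBoundedParabolicPt (Γ false ⊔ Γ true) d := by
  rintro ⟨-, K, hK, hKsub, hKcov⟩
  have hJG : J ≤ Γ false ⊔ Γ true := (hP.le i).trans hΓG
  have hnotcon : ∀ (h : ℕ → X ≃ₜ X) (a b : X), ¬ConicalSeq (Γ false ⊔ Γ true) h d a b :=
    fun h a b => hd.not_conicalSeq hG hJG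
  obtain ⟨e', φ, hφ, he'⟩ := exists_tendsto_subseq fun k => f k d
  replace hf := hf.comp hφ
  replace hc : IsConvSeq (f ∘ φ) c d := hc.comp_tendsto hφ.tendsto_atTop
  replace he' : Tendsto (fun k => (f ∘ φ) k d) atTop (𝓝 e') := he'
  generalize f ∘ φ = f₁ at hf hc he'
  have hlim : ∀ {w : ℕ → X} {y : X}, (∀ k, w k ∈ limitSet (Γ i)) →
      Tendsto (fun k => f₁ k (w k)) atTop (𝓝 y) → y ∈ limitSet (Γ false ⊔ Γ true) :=
    fun hw hy => (isClosed_limitSet hG).mem_of_tendsto hy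
      (.of_forall fun k => apply_mem_limitSet (hf.mem k) (limitSet_mono hΓG (hw k)))
  obtain ⟨y, hy, hye⟩ : ∃ y ∈ limitSet (Γ false ⊔ Γ true), y ≠ e' := by
    by_cases h : a = e'
    · exact ⟨b, hlim hf.snd_mem hf.snd_lim, fun e => hf.ne (h.trans e.symm)⟩
    · exact ⟨a, hlim hf.fst_mem hf.fst_lim, h⟩
  have hq : ∀ k, ∃ q ∈ J, q d = d ∧ ((f₁ k)⁻¹ y ≠ d → q ((f₁ k)⁻¹ y) ∈ K) := by
    intro k
    by_cases h : (f₁ k)⁻¹ y = d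
    · exact ⟨1, J.one_mem, rfl, fun h' => absurd h h'⟩
    · obtain ⟨q, hq, hqd, hqK⟩ :=
        hKcov _ ⟨apply_mem_limitSet (Subgroup.inv_mem _ (hf.mem k)) hy, h⟩
      exact ⟨q, hP.stabilizer_le hdJ hq hqd, hqd, fun _ => hqK⟩
  choose q hqJ hqd hqK using hq
  have hev : ∀ᶠ k in atTop, q k ((f₁ k)⁻¹ y) ∈ K := by
    filter_upwards [he'.eventually_ne hye.symm] with k hk
    exact hqK k fun h => hk ((homeo_inv_apply_eq_iff _).1 h).symm
  obtain ⟨e, heK, φ₁, hφ₁, he⟩ := hK.tendsto_subseq' hev.frequently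
  obtain ⟨φ₂, hφ₂, c', d', hc'⟩ := hG.exists_isConvSeq (f := fun k => f₁ (φ₁ k) * (q (φ₁ k))⁻¹)
    (fun k => Subgroup.mul_mem _ (hf.mem _) (Subgroup.inv_mem _ (hJG (hqJ _))))
    ((hf.tendsto_cofinite fun k => (Γ i).inv_mem (hP.le i (hqJ k))).comp hφ₁.tendsto_atTop)
  have hσ : StrictMono (φ₁ ∘ φ₂) := hφ₁.comp hφ₂
  replace he := he.comp hφ₂.tendsto_atTop
  replace he' := he'.comp hσ.tendsto_atTop
  replace hc := hc.comp_tendsto hσ.tendsto_atTop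
  replace hf := hf.comp hσ
  replace hqJ : ∀ k, q (φ₁ (φ₂ k)) ∈ J := fun k => hqJ _
  replace hqd : ∀ k, q (φ₁ (φ₂ k)) d = d := fun k => hqd _
  have hqd' : ∀ k, (q (φ₁ (φ₂ k)))⁻¹ d = d := fun k => (homeo_inv_apply_eq_iff _).2 (hqd k).symm
  by_cases hdd : d' = d
  · subst hdd
    have hcy : c' = y := by
      refine tendsto_nhds_unique (hc'.tendsto he (hKsub heK).2) ?_
      simp
    refine hnotcon _ e' y ⟨fun k => ?_, hcy ▸ hc', ?_, hye.symm⟩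
    · exact Subgroup.mul_mem _ (hf.mem k) (Subgroup.inv_mem _ (hJG (hqJ k)))
    · simpa [homeo_mul_apply, hqd', Function.comp_def] using he'
  · have hcof : Tendsto (fun k => q (φ₁ (φ₂ k))) atTop cofinite := by
      refine tendsto_iff_forall_eventually_mem.2 fun s hs => ?_
      have hfin : sᶜ.Finite := hs
      have hg : ∀ g, ∀ᶠ k in atTop, q (φ₁ (φ₂ k)) ≠ g := fun g => by
        by_contra hfreq
        simp only [not_eventually, not_not] at hfreq
        obtain ⟨y', hy₁, hy₂⟩ := exists_ne_ne c c'
        have hlim₁ := (g.continuous.tendsto _).comp (hc.inv.tendsto_apply hy₁)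
        have hlim₂ := hc'.inv.tendsto_apply hy₂
        obtain ⟨k, hk⟩ := hfreq.exists
        refine hdd ((tendsto_nhds_unique_of_frequently_eq hlim₂ hlim₁ (hfreq.mono ?_)).trans
          (hk ▸ hqd k))
        rintro k rfl
        simp
      filter_upwards [(eventually_all_finite hfin).2 fun g _ => hg g] with k hk
      by_contra hmem
      exact hk _ hmem rfl
    obtain ⟨ψ, hψ, α, β, hαβ⟩ := (hG.mono hJG).exists_isConvSeq hqJ hcof
    obtain ⟨rfl, rfl⟩ :=
      isConvSeq_of_fixed_parabolic hnotcon (fun k => hJG (hqJ (ψ k))) (fun k => hqd (ψ k)) hαβ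
    obtain ⟨A, hA, hlt⟩ := hW.eventually_wallDist_lt hθ (fun U hU => hc.inv.exists_mem_ne hU) hdd
      (fun k => hqJ (ψ k)) hαβ
    obtain ⟨n, hn, hnA⟩ := (hlt.and
      ((hc'.inv.comp_tendsto hψ.tendsto_atTop).eventually_maj hθ hA)).exists
    have := hn _ ((Homeomorph.injective _).comp hθ) hnA
    simp only [Function.comp_apply, mul_inv_rev, inv_inv, homeo_mul_apply,
      homeo_inv_apply_self] at this
    exact absurd (hf.min (ψ n) _ (hqJ (ψ n))) (not_le.2 this)

end MinimalSequences

section Main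

theorem le_sup_bool {A : Type*} [Group A] (Γ : Bool → Subgroup A) (i : Bool) :
    Γ i ≤ Γ false ⊔ Γ true := by
  cases i
  · exact le_sup_left
  · exact le_sup_right

variable {X : Type*} [MetricSpace X] [CompactSpace X] [Infinite X]

variable {Γ : Bool → Subgroup (X ≃ₜ X)} {J : Subgroup (X ≃ₜ X)} {B : Bool → Set X} {i : Bool}

theorem PingPong.not_minSeq (hP : PingPong Γ J B) (hΓ : IsDiscreteConvGroup (Γ i))
    (hG : IsDiscreteConvGroup (Γ false ⊔ Γ true)) (hJgf : IsGeomFinite J)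
    (hGgf : IsGeomFinite (Γ false ⊔ Γ true)) {W : Set (Set X × Set X)} {θ : Fin 3 → X}
    (hθ : Function.Injective θ) (hW : WallSystem J θ W) {f : ℕ → X ≃ₜ X} {u v : ℕ → X} {a b : X} :
    ¬MinSeq Γ J i W θ f u v a b := fun hf => by
  have hJG : J ≤ Γ false ⊔ Γ true := (hP.le i).trans (le_sup_bool Γ i)
  have hJ := hG.mono hJG
  have hcof : Tendsto f atTop cofinite := by
    simpa using hf.tendsto_cofinite (q := fun _ => 1) fun _ => (Γ i).one_mem
  obtain ⟨φ, hφ, c, d, hc⟩ := hG.exists_isConvSeq hf.mem hcof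
  replace hf := hf.comp hφ
  have hdJ : d ∈ limitSet J := by
    by_contra hd
    exact Set.disjoint_left.1 (hP.disjoint (!i))
      (hP.lim i ⟨hf.repelling_mem_limitSet hΓ hc, hd⟩) (by simpa using hf.repelling_mem hP hc)
  obtain ⟨j, hj, hinj, hcon⟩ | hpar := hJgf d hdJ
  · obtain ⟨ψ, -, a', b', hcs⟩ := exists_conicalSeq hJ hj hinj hcon
    exact hf.repelling_not_conical hW hθ hc hcs
  · obtain ⟨j, hj, hinj, hcon⟩ | hpar' := hGgf d (limitSet_mono hJG hdJ)
    · obtain ⟨ψ, -, a', b', hcs⟩ := exists_conicalSeq hG hj hinj hcon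
      exact hpar.1.not_conicalSeq hG hJG hcs
    · exact hf.repelling_not_parabolic hP hW hθ hG (le_sup_bool Γ i) hc hdJ hpar.1 hpar'

theorem PingPong.exists_frequently_mem (hP : PingPong Γ J B) (hΓ : IsDiscreteConvGroup (Γ i))
    (hG : IsDiscreteConvGroup (Γ false ⊔ Γ true)) (hJgf : IsGeomFinite J)
    (hGgf : IsGeomFinite (Γ false ⊔ Γ true)) (hinf : (Γ i : Set (X ≃ₜ X)).Infinite) {x : X}
    (hx : x ∈ limitSet (Γ i)) {h : ℕ → X ≃ₜ X} {a b : X}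
    (hh : ConicalSeq (Γ false ⊔ Γ true) h x a b) :
    ∃ g ∈ Γ false ⊔ Γ true, ∃ᶠ k in atTop, g⁻¹ * h k ∈ Γ i := by
  by_contra! hne
  have hΓG := le_sup_bool Γ i
  have hleave : ∀ g, ∀ᶠ k in atTop, g⁻¹ * h k ∉ Γ i := fun g => by
    by_cases hg : g ∈ Γ false ⊔ Γ true
    · exact hne g hg
    · refine .of_forall fun k hk => hg ?_
      have := Subgroup.mul_mem _ (hh.mem k) (Subgroup.inv_mem _ (hΓG hk))
      simpa using this
  obtain ⟨N, hN⟩ := eventually_atTop.1 (hleave 1)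
  obtain ⟨z, hz, hzx⟩ := Set.not_subset.1 (hh.not_limitSet_subset hG hΓG hinf)
  obtain ⟨θ, hθ⟩ := exists_injective_triple (X := X)
  obtain ⟨W, hW⟩ := (hG.mono ((hP.le i).trans hΓG)).exists_wallSystem hθ
  have hmin : ∀ k, ∃ c ∈ Γ i, (∃ l, AltForm Γ J l (!i) (h (k + N) * c⁻¹)) ∧
      ∀ c' ∈ Γ i, (∃ l, AltForm Γ J l (!i) (h (k + N) * c'⁻¹)) →
        wallDist W θ (fun l => c ((h (k + N))⁻¹ (θ l))) ≤
          wallDist W θ fun l => c' ((h (k + N))⁻¹ (θ l)) := by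
    intro k
    have hk := hN (k + N) (by omega)
    rw [inv_one, one_mul] at hk
    obtain ⟨c, hc, hc'⟩ :=
      (mem_or_exists_altForm_mul_inv hP.le (hh.mem (k + N)) i).resolve_left hk
    let S : Set (X ≃ₜ X) := {c | c ∈ Γ i ∧ ∃ l, AltForm Γ J l (!i) (h (k + N) * c⁻¹)}
    have hS : S.Nonempty := ⟨c, hc, hc'⟩
    let F : (X ≃ₜ X) → ℕ := fun c => wallDist W θ fun l => c ((h (k + N))⁻¹ (θ l))
    exact ⟨Function.argminOn F S hS, (Function.argminOn_mem F S hS).1,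
      (Function.argminOn_mem F S hS).2, fun c' h₁ h₂ => Function.argminOn_le F S ⟨h₁, h₂⟩⟩
  choose c hc hform hcmin using hmin
  have hshift : Tendsto (fun k => k + N) atTop atTop := tendsto_add_atTop_nat N
  refine hP.not_minSeq hΓ hG hJgf hGgf hθ hW (f := fun k => h (k + N) * (c k)⁻¹)
    (u := fun k => c k x) (v := fun k => c k z) (a := a) (b := b) ⟨hform, fun k => ?_,
      fun k j hj => ?_, fun g => ?_, fun k => apply_mem_limitSet (hc k) hx,
      fun k => apply_mem_limitSet (hc k) hz, ?_, ?_, hh.ne⟩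
  · exact Subgroup.mul_mem _ (hh.mem _) (Subgroup.inv_mem _ (hΓG (hc k)))
  · have := hcmin k (j * c k) ((Γ i).mul_mem (hP.le i hj) (hc k)) ?_
    · simpa using this
    · obtain ⟨l, hl⟩ := hform k
      refine ⟨l, ?_⟩
      rw [mul_inv_rev, ← mul_assoc]
      exact hl.mul_subgroup hP.le (J.inv_mem hj)
  · filter_upwards [hshift.eventually (hleave g)] with k hk hmem
    refine hk ?_
    have := (Γ i).inv_mem ((Γ i).mul_mem ((Γ i).inv_mem (hc k)) hmem)
    simpa [mul_assoc] using this
  · simpa [Function.comp_def] using hh.lim.comp hshift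
  · simpa [Function.comp_def] using (hh.conv.tendsto_apply hzx).comp hshift

theorem AFPPingPong.pingPong {X : Type*} [MetricSpace X] {G₁ G₂ J : Subgroup (X ≃ₜ X)}
    {B₁ B₂ : Set X} (h : AFPPingPong G₁ G₂ J B₁ B₂) (h₁ : J < G₁) (h₂ : J < G₂) :
    PingPong (fun i => cond i G₂ G₁) J fun i => closure (interior (cond i B₂ B₁)) := by
  have hsub : ∀ B : Set X, interior B ⊆ interior (closure (interior B)) := fun B =>
    interior_maximal subset_closure isOpen_interior
  have hcl : ∀ {B : Set X}, IsClosed B → closure (interior B) ⊆ B := fun hB =>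
    closure_minimal interior_subset hB
  have hdisj : ∀ {U V : Set X}, IsOpen U → IsOpen V → Disjoint U V →
      Disjoint (interior (closure U)) (closure V) := fun hU hV hUV =>
    ((hUV.closure_left hV).mono_left interior_subset).closure_right isOpen_interior
  have hB := Set.disjoint_iff_inter_eq_empty.2 h.int_disjoint
  have hinv : ∀ {B : Set X} {j : X ≃ₜ X}, j '' B = B → ∀ y ∈ closure (interior B),
      j y ∈ closure (interior B) := fun {B j} hB y hy => by
    rw [← hB, ← j.image_interior, ← j.image_closure]
    exact Set.mem_image_of_mem j hy
  refine ⟨fun i => isClosed_closure, ?_, ?_, ?_, ?_, ?_, ?_, ?_⟩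
  · rintro (_ | _)
    · exact h.int_nonempty₁.mono (hsub _)
    · exact h.int_nonempty₂.mono (hsub _)
  · rintro (_ | _)
    · exact hdisj isOpen_interior isOpen_interior hB
    · exact hdisj isOpen_interior isOpen_interior hB.symm
  · rintro (_ | _) j hj
    · exact hinv (h.inv₁ j hj)
    · exact hinv (h.inv₂ j hj)
  · rintro (_ | _) g hg hgJ y hy
    · exact hsub _ (h.pp₁ g hg hgJ (Set.mem_image_of_mem g (hcl h.isClosed₁ hy)))
    · exact hsub _ (h.pp₂ g hg hgJ (Set.mem_image_of_mem g (hcl h.isClosed₂ hy)))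
  · rintro (_ | _)
    · exact h.lim₁.trans (hsub _)
    · exact h.lim₂.trans (hsub _)
  · rintro (_ | _)
    · exact h₁.le
    · exact h₂.le
  · rintro (_ | _)
    · exact SetLike.exists_of_lt h₁
    · exact SetLike.exists_of_lt h₂

theorem infinite_of_injective_homeo {X : Type*} [TopologicalSpace X] {h : ℕ → X ≃ₜ X}
    (hinj : Function.Injective h) : Infinite X := by
  refine not_finite_iff_infinite.1 fun _ => ?_
  have : Finite (X ≃ₜ X) := Finite.of_injective _ (Homeomorph.toEquiv_injective (X := X) (Y := X))
  exact not_injective_infinite_finite h hinj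

theorem PingPong.exists_subseq_mem (hP : PingPong Γ J B) (hΓ : ∀ i, IsDiscreteConvGroup (Γ i))
    (hconv : IsConvGroup (Γ false ⊔ Γ true)) (hJgf : IsGeomFinite J)
    (hGgf : IsGeomFinite (Γ false ⊔ Γ true)) {x : X} (hx : x ∈ limitSet (Γ i))
    {h : ℕ → X ≃ₜ X} (hh : ∀ k, h k ∈ Γ false ⊔ Γ true) (hinj : Function.Injective h)
    (hcon : ∀ z : X, z ≠ x → ∃ K : Set (X × X), IsCompact K ∧ (∀ p ∈ K, p.1 ≠ p.2) ∧
      ∀ k, (h k x, h k z) ∈ K) :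
    ∃ φ : ℕ → ℕ, StrictMono φ ∧ ∃ g ∈ Γ false ⊔ Γ true, ∀ k, g⁻¹ * h (φ k) ∈ Γ i := by
  have hinf : (Γ i : Set (X ≃ₜ X)).Infinite := by
    obtain ⟨g, hg, hg', -⟩ := hx
    exact Set.infinite_of_injective_forall_mem hg' hg
  have hG := hP.isDiscreteConvGroup ((hΓ i).mono (hP.le i)) hinf hconv
  obtain ⟨φ, hφ, a, b, hc⟩ := exists_conicalSeq hG hh hinj hcon
  obtain ⟨g, hg, hfreq⟩ := hP.exists_frequently_mem (hΓ i) hG hJgf hGgf hinf hx hc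
  obtain ⟨ψ, hψ, hmem⟩ := extraction_of_frequently_atTop hfreq
  exact ⟨φ ∘ ψ, hφ.comp hψ, g, hg, hmem⟩

end Main

/-- Assume `G` is geometrically finite. Let `x ∈ Λ(G_i)` for
`i ∈ {1,2}` (index `0` stands for `G₁`, `1` for `G₂`), and let `(h k)` be a conical
limiting sequence in `G` for `x`. Then after passing to a subsequence there is `h ∈ G`
such that `h k ∈ h G_i` for every `k`. -/
theorem statement_18 {M : Type*} [TopologicalSpace M] [CompactSpace M]
    [TopologicalSpace.MetrizableSpace M]
    (G₁ G₂ J G : Subgroup (M ≃ₜ M))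
    (hd₁ : IsDiscreteConvGroup G₁) (hd₂ : IsDiscreteConvGroup G₂)
    (hJ : J = G₁ ⊓ G₂) (hJgf : IsGeomFinite J) (hJlt₁ : J < G₁) (hJlt₂ : J < G₂)
    (hpp : ∃ B₁ B₂ : Set M, AFPPingPong G₁ G₂ J B₁ B₂)
    (hG : G = G₁ ⊔ G₂) (hGconv : IsConvGroup G)
    (hGgf : IsGeomFinite G)
    (i : Fin 2) (x : M) (hx : x ∈ limitSet (if i = 0 then G₁ else G₂))
    (h : ℕ → M ≃ₜ M) (hhG : ∀ k, h k ∈ G) (hinj : Function.Injective h)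
    (hcon : ∀ z : M, z ≠ x → ∃ K : Set (M × M), IsCompact K ∧ (∀ p ∈ K, p.1 ≠ p.2) ∧
      ∀ k, (h k x, h k z) ∈ K) :
    ∃ φ : ℕ → ℕ, StrictMono φ ∧ ∃ g : M ≃ₜ M, g ∈ G ∧
      ∀ k, g⁻¹ * h (φ k) ∈ (if i = 0 then G₁ else G₂) := by
  let := TopologicalSpace.metrizableSpaceMetric M
  have := infinite_of_injective_homeo hinj
  subst hG
  obtain ⟨B₁, B₂, hpp⟩ := hpp
  have key := fun i => (hpp.pingPong hJlt₁ hJlt₂).exists_subseq_mem (i := i) (x := x) (h := h)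
    (by rintro (_ | _) <;> assumption) hGconv hJgf hGgf
  match i with
  | 0 => exact key false hx hhG hinj hcon
  | 1 => exact key true hx hhG hinj hcon


end ConvergenceGroups
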